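/- arXiv:2604.08452 — 3 statements merged into one kernel-verified Lean document; each statement's English description precedes it below -/
import Mathlib

section
/- Let D ⊂ ℂ^n be a bounded domain with smooth boundary, witnessed by a C^∞ function ρ on an open neighborhood of the closure of D with D = {ρ < 0}, ∂D = {ρ = 0}, and gradient of ρ nonvanishing on ∂D. Assume every automorphism of D extends to a smooth diffeomorphism of the closure of D, and that convergence of automorphisms uniformly on compact subsets of D implies convergence of all derivatives of the extensions uniformly on the closure of D. Let H be a compact subgroup of the automorphism group of D. Then there exists a compact set K ⊂ D such that for every f ∈ H whose fixed point set is discrete in D, all fixed points of f lie in K. -/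
open Set Metric Filter Topology

noncomputable section

/-- `ℂ^n` with the Euclidean norm. -/
abbrev CSpace (n : ℕ) := EuclideanSpace ℂ (Fin n)

/-- `f` is an automorphism of the set `D`: a holomorphic bijection of `D` onto
itself with a holomorphic inverse. -/
def AutOn {n : ℕ} (D : Set (CSpace n)) (f : CSpace n → CSpace n) : Prop :=
  DifferentiableOn ℂ f D ∧ Set.BijOn f D D ∧
  ∃ g : CSpace n → CSpace n, DifferentiableOn ℂ g D ∧ Set.BijOn g D D ∧
    (∀ z ∈ D, g (f z) = z) ∧ (∀ z ∈ D, f (g z) = z)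

/-- The fixed point set of `f` in `D`. -/
def FixOn {n : ℕ} (D : Set (CSpace n)) (f : CSpace n → CSpace n) : Set (CSpace n) :=
  {z ∈ D | f z = z}

/-- Every point of `S` is isolated in `S`. -/
def DiscreteIn {n : ℕ} (S : Set (CSpace n)) : Prop :=
  ∀ z ∈ S, ∃ ε > 0, ∀ w ∈ S, w ≠ z → ε ≤ dist w z

/-- `f` extends holomorphically beyond the boundary of `D`. -/
def ExtendsHolo {n : ℕ} (D : Set (CSpace n)) (f : CSpace n → CSpace n) : Prop :=
  ∃ U : Set (CSpace n), IsOpen U ∧ closure D ⊆ U ∧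
    ∃ F : CSpace n → CSpace n, DifferentiableOn ℂ F U ∧ Set.EqOn F f D

/-- `H` is a compact subgroup of the automorphism group of `D`. -/
def IsCompactAutGroup {n : ℕ} (D : Set (CSpace n))
    (H : Set (CSpace n → CSpace n)) : Prop :=
  (∀ f ∈ H, AutOn D f) ∧
  (∃ e ∈ H, ∀ z ∈ D, e z = z) ∧
  (∀ f ∈ H, ∀ g ∈ H, ∃ h ∈ H, ∀ z ∈ D, h z = f (g z)) ∧
  (∀ f ∈ H, ∃ g ∈ H, (∀ z ∈ D, g (f z) = z) ∧ (∀ z ∈ D, f (g z) = z)) ∧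
  (∀ u : ℕ → (CSpace n → CSpace n), (∀ k, u k ∈ H) →
    ∃ φ : ℕ → ℕ, StrictMono φ ∧ ∃ f ∈ H, ∀ K : Set (CSpace n), K ⊆ D → IsCompact K →
      TendstoUniformlyOn (fun k => u (φ k)) f Filter.atTop K)

/-- `D` has smooth boundary, witnessed by the defining function `ρ` defined on the
open neighborhood `V` of the closure of `D`. -/
def SmoothDefiningFn {n : ℕ} (D V : Set (CSpace n)) (ρ : CSpace n → ℝ) : Prop :=
  IsOpen V ∧ closure D ⊆ V ∧ ContDiffOn ℝ (⊤ : ℕ∞) ρ V ∧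
    D = {z ∈ V | ρ z < 0} ∧ frontier D = {z ∈ V | ρ z = 0} ∧
    ∀ z ∈ frontier D, fderiv ℝ ρ z ≠ 0

/-- `F` is a smooth extension of `f` to the closure of `D` which is a diffeomorphism
of the closure of `D`. -/
def SmoothDiffeoExt {n : ℕ} (D : Set (CSpace n)) (f F : CSpace n → CSpace n) : Prop :=
  ContDiffOn ℝ (⊤ : ℕ∞) F (closure D) ∧ Set.EqOn F f D ∧
    Set.BijOn F (closure D) (closure D) ∧
    ∃ G : CSpace n → CSpace n, ContDiffOn ℝ (⊤ : ℕ∞) G (closure D) ∧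
      (∀ z ∈ closure D, G (F z) = z) ∧ (∀ z ∈ closure D, F (G z) = z)

/-- Convergence of automorphisms uniformly on compact subsets of `D` implies
`C^∞`-convergence of the extensions on the closure of `D`. -/
def SmoothConvergenceProperty {n : ℕ} (D : Set (CSpace n)) : Prop :=
  ∀ (u : ℕ → CSpace n → CSpace n) (f : CSpace n → CSpace n),
    (∀ k, AutOn D (u k)) → AutOn D f →
    (∀ K : Set (CSpace n), K ⊆ D → IsCompact K →
      TendstoUniformlyOn u f Filter.atTop K) →
    ∀ (F : ℕ → CSpace n → CSpace n) (F₀ : CSpace n → CSpace n),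
      (∀ k, SmoothDiffeoExt D (u k) (F k)) → SmoothDiffeoExt D f F₀ →
      ∀ j : ℕ,
        TendstoUniformlyOn
          (fun k => iteratedFDerivWithin ℝ j (F k) (closure D))
          (iteratedFDerivWithin ℝ j F₀ (closure D)) Filter.atTop (closure D)


section BoundedHolomorphic

variable {E F : Type*} [NormedAddCommGroup E] [NormedSpace ℂ E]
  [NormedAddCommGroup F] [NormedSpace ℂ F]

/-- Cauchy estimate for the derivative of a bounded holomorphic map. -/
theorem norm_fderiv_le_of_norm_le {h : E → F} {z : E} {R M : ℝ} (hR : 0 < R)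
    (hd : DifferentiableOn ℂ h (ball z R)) (hb : ∀ x ∈ ball z R, ‖h x‖ ≤ M) :
    ‖fderiv ℂ h z‖ ≤ 2 * M / R := by
  refine Complex.norm_fderiv_le_div_of_mapsTo_ball hd (fun x hx => ?_) hR
  rw [mem_closedBall, dist_eq_norm]
  have h1 := hb x hx
  have h2 := hb z (mem_ball_self hR)
  exact (norm_sub_le _ _).trans (by linarith)

/-- Lipschitz estimate for the derivative of a bounded holomorphic map. -/
theorem norm_fderiv_sub_fderiv_le_of_norm_le {h : E → F} {z w : E} {R M : ℝ} (hR : 0 < R)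
    (hd : DifferentiableOn ℂ h (ball z R)) (hb : ∀ x ∈ ball z R, ‖h x‖ ≤ M)
    (hw : w ∈ ball z (R / 4)) :
    ‖fderiv ℂ h w - fderiv ℂ h z‖ ≤ 32 * M / R ^ 2 * ‖w - z‖ := by
  have hat : ∀ x ∈ ball z R, DifferentiableAt ℂ h x := fun x hx =>
    (hd x hx).differentiableAt (isOpen_ball.mem_nhds hx)
  have hfd : ∀ x ∈ ball z (R / 2), ‖fderiv ℂ h x‖ ≤ 4 * M / R := by
    intro x hx
    have hsub : ball x (R / 2) ⊆ ball z R := ball_subset_ball' (by rw [mem_ball] at hx; linarith)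
    refine (norm_fderiv_le_of_norm_le (half_pos hR) (hd.mono hsub)
      (fun y hy => hb y (hsub hy))).trans (le_of_eq ?_)
    field_simp
    ring
  have hw' : ‖w - z‖ < R / 4 := by rwa [mem_ball, dist_eq_norm] at hw
  have hmem : ∀ x ∈ ball z (R / 4), x + (w - z) ∈ ball z (R / 2) := by
    intro x hx
    rw [mem_ball, dist_eq_norm] at *
    calc ‖x + (w - z) - z‖ = ‖(x - z) + (w - z)‖ := by congr 1; abel
      _ ≤ ‖x - z‖ + ‖w - z‖ := norm_add_le _ _
      _ < R / 2 := by linarith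
  have h42 : ball z (R / 4) ⊆ ball z (R / 2) := ball_subset_ball (by linarith)
  have h21 : ball z (R / 2) ⊆ ball z R := ball_subset_ball (by linarith)
  have hk : ∀ x ∈ ball z (R / 4), HasFDerivAt (fun x => h (x + (w - z)) - h x)
      (fderiv ℂ h (x + (w - z)) - fderiv ℂ h x) x := by
    intro x hx
    have h1 := (hat _ (h21 (hmem x hx))).hasFDerivAt
    exact ((hasFDerivAt_comp_add_right (w - z)).2 h1).sub (hat x (h21 (h42 hx))).hasFDerivAt
  have hz := mem_ball_self (x := z) (show 0 < R / 4 by linarith)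
  have key := norm_fderiv_le_of_norm_le (h := fun x => h (x + (w - z)) - h x) (z := z)
    (M := 4 * M / R * ‖w - z‖) (show 0 < R / 4 by linarith)
    (fun x hx => (hk x hx).differentiableAt.differentiableWithinAt) (fun x hx => by
      have := (convex_ball z (R / 2)).norm_image_sub_le_of_norm_fderiv_le (𝕜 := ℂ)
        (fun y hy => hat y (h21 hy)) hfd (h42 hx) (hmem x hx)
      simpa using this)
  rw [(hk z hz).fderiv, add_sub_cancel] at key
  refine key.trans (le_of_eq ?_)
  field_simp
  ring

end BoundedHolomorphic

section Linearization

variable {E : Type*} [NormedAddCommGroup E] [NormedSpace ℂ E]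

/-- At a fixed point `z`, the powers of the derivative of a self-map of a bounded open set are
bounded. -/
theorem exists_norm_fderiv_pow_le {D : Set E} (hD : IsOpen D) (hb : Bornology.IsBounded D)
    {f : E → E} (hf : DifferentiableOn ℂ f D) (hfD : MapsTo f D D) {z : E} (hz : z ∈ D)
    (hfz : f z = z) : ∃ C > 0, ∀ j, ‖fderiv ℂ f z ^ j‖ ≤ C := by
  obtain ⟨M, hM0, hM⟩ := hb.exists_pos_norm_le
  obtain ⟨R, hR, hRD⟩ := Metric.isOpen_iff.1 hD z hz
  refine ⟨2 * M / R, by positivity, fun j => ?_⟩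
  rw [← ((hf.differentiableAt (hD.mem_nhds hz)).hasFDerivAt.iterate hfz j).fderiv]
  exact norm_fderiv_le_of_norm_le hR ((hf.iterate hfD j).mono hRD)
    fun x hx => hM _ (hfD.iterate j (hRD hx))

/-- A linearization of an automorphism near a fixed point, obtained as a limit of averages. -/
theorem exists_linearization [FiniteDimensional ℂ E] {D : Set E} (hD : IsOpen D)
    (hb : Bornology.IsBounded D) {f g : E → E} (hf : DifferentiableOn ℂ f D)
    (hg : DifferentiableOn ℂ g D) (hfD : MapsTo f D D) (hgD : MapsTo g D D)
    (hgf : ∀ x ∈ D, g (f x) = x) (hfg : ∀ x ∈ D, f (g x) = x) {z : E} (hz : z ∈ D)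
    (hfz : f z = z) :
    ∃ Φ : E → E, Φ z = 0 ∧ (∀ x ∈ D, Φ (f x) = fderiv ℂ f z (Φ x)) ∧
      ∃ r > 0, ball z r ⊆ D ∧
        ApproximatesLinearOn Φ (ContinuousLinearMap.id ℂ E) (ball z r) (1 / 2) := by
  have hgz : g z = z := by simpa [hfz] using hgf z hz
  obtain ⟨M, hM0, hM⟩ := hb.exists_pos_norm_le
  obtain ⟨R, hR, hRD⟩ := Metric.isOpen_iff.1 hD z hz
  obtain ⟨C, hC0, hC⟩ := exists_norm_fderiv_pow_le hD hb hg hgD hz hgz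
  set T := fderiv ℂ f z with hT
  set S := fderiv ℂ g z with hS
  have hfz' := (hf.differentiableAt (hD.mem_nhds hz)).hasFDerivAt
  have hgz' := (hg.differentiableAt (hD.mem_nhds hz)).hasFDerivAt
  have hone : ∀ {a b : E → E}, HasFDerivAt a (fderiv ℂ a z) z → HasFDerivAt b (fderiv ℂ b z) z →
      b z = z → (∀ x ∈ D, a (b x) = x) → fderiv ℂ a z * fderiv ℂ b z = 1 := by
    intro a b ha hb' hbz hab
    have h1 : HasFDerivAt (fun x => a (b x)) (fderiv ℂ a z * fderiv ℂ b z) z :=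
      HasFDerivAt.comp z (by rwa [hbz]) hb'
    refine h1.unique ((hasFDerivAt_id z).congr_of_eventuallyEq ?_)
    filter_upwards [hD.mem_nhds hz] with x hx using hab x hx
  have hST : S * T = 1 := hone hgz' hfz' hfz hgf
  have hTS : T * S = 1 := hone hfz' hgz' hgz hfg
  have hpow : ∀ j, S ^ j * T ^ j = 1 := fun j => by
    rw [← (show Commute S T from hST.trans hTS.symm).mul_pow, hST, one_pow]
  -- the terms to be averaged
  let h : ℕ → E → E := fun j x => (S ^ j) (f^[j] x - z)
  have hhz : ∀ j, h j z = 0 := fun j => by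
    simp only [h, Function.iterate_fixed hfz, sub_self, map_zero]
  have hhf : ∀ j x, h j (f x) = T (h (j + 1) x) := fun j x => by
    simp only [h, ← Function.iterate_succ_apply]
    rw [pow_succ', ← mul_apply_eq_comp, ← mul_assoc, hTS, one_mul]
  have hhb : ∀ j, ∀ x ∈ D, ‖h j x‖ ≤ C * (2 * M) := fun j x hx => by
    refine ((S ^ j).le_opNorm _).trans ?_
    have h1 := hM _ (hfD.iterate j hx)
    have h2 := hM _ hz
    have h3 : ‖f^[j] x - z‖ ≤ 2 * M := (norm_sub_le _ _).trans (by linarith)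
    exact mul_le_mul (hC j) h3 (norm_nonneg _) hC0.le
  have hhd : ∀ j, DifferentiableOn ℂ (h j) D := fun j =>
    (S ^ j).differentiable.comp_differentiableOn ((hf.iterate hfD j).sub_const z)
  have hh1 : ∀ j, fderiv ℂ (h j) z = ContinuousLinearMap.id ℂ E := fun j => by
    have := (S ^ j).hasFDerivAt.comp z ((hfz'.iterate hfz j).sub_const z)
    exact this.fderiv.trans (hpow j)
  let L := 32 * (C * (2 * M)) / R ^ 2
  have hL : 0 < L := by positivity
  let r := min (R / 4) (1 / (2 * L))
  have hr : 0 < r := by positivity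
  have hrR : ball z r ⊆ ball z (R / 4) := ball_subset_ball (min_le_left _ _)
  have hrD : ball z r ⊆ D := hrR.trans ((ball_subset_ball (by linarith)).trans hRD)
  have happ : ∀ j, ∀ x ∈ ball z r, ∀ y ∈ ball z r,
      ‖h j x - h j y - (x - y)‖ ≤ 1 / 2 * ‖x - y‖ := by
    intro j x hx y hy
    refine (convex_ball z r).norm_image_sub_le_of_norm_fderiv_le' (𝕜 := ℂ)
      (φ := ContinuousLinearMap.id ℂ E)
      (fun w hw => (hhd j).differentiableAt (hD.mem_nhds (hrD hw))) (fun w hw => ?_) hy hx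
    rw [← hh1 j]
    refine (norm_fderiv_sub_fderiv_le_of_norm_le hR ((hhd j).mono hRD)
      (fun y hy => hhb j y (hRD hy)) (hrR hw)).trans ?_
    have h1 : ‖w - z‖ ≤ 1 / (2 * L) := by
      rw [mem_ball, dist_eq_norm] at hw
      exact hw.le.trans (min_le_right _ _)
    calc L * ‖w - z‖ ≤ L * (1 / (2 * L)) := by gcongr
      _ = 1 / 2 := by field_simp
  -- the averages
  let A : ℕ → E → E := fun N x => ((N + 1 : ℝ)⁻¹) • ∑ j ∈ Finset.range (N + 1), h j x
  have hAle : ∀ (N : ℕ) (a : ℕ → E) (c : ℝ), (∀ j, ‖a j‖ ≤ c) →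
      ‖((N + 1 : ℝ)⁻¹) • ∑ j ∈ Finset.range (N + 1), a j‖ ≤ c := by
    intro N a c hac
    rw [norm_smul, Real.norm_of_nonneg (by positivity), inv_mul_le_iff₀ (by positivity)]
    refine (norm_sum_le_of_le _ fun j _ => hac j).trans (le_of_eq ?_)
    simp
  have : ProperSpace E := FiniteDimensional.proper ℂ E
  let U : Ultrafilter ℕ := Ultrafilter.of atTop
  have hU : (U : Filter ℕ) ≤ atTop := Ultrafilter.of_le atTop
  have hlim : ∀ x, ∃ y, x ∈ D → Tendsto (fun N => A N x) U (𝓝 y) := by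
    intro x
    by_cases hx : x ∈ D
    · obtain ⟨y, -, hy⟩ := (isCompact_closedBall (0 : E) (C * (2 * M))).ultrafilter_le_nhds
        (U.map fun N => A N x) (by
          rw [Ultrafilter.coe_map, le_principal_iff, mem_map]
          exact Eventually.of_forall fun N => by
            rw [mem_closedBall_zero_iff]
            exact hAle N _ _ fun j => hhb j x hx)
      exact ⟨y, fun _ => hy⟩
    · exact ⟨0, fun h => absurd h hx⟩
  choose Φ hΦ using hlim
  refine ⟨Φ, ?_, fun x hx => ?_, r, hr, hrD, ?_⟩
  · refine tendsto_nhds_unique (hΦ z hz) ?_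
    simp [A, hhz]
  · have h1 : Tendsto (fun N => A N (f x) - T (A N x)) U (𝓝 (Φ (f x) - T (Φ x))) :=
      (hΦ _ (hfD hx)).sub ((T.continuous.tendsto _).comp (hΦ x hx))
    have h2 : Tendsto (fun N => A N (f x) - T (A N x)) U (𝓝 0) := by
      have h3 : Tendsto (fun N : ℕ => (N + 1 : ℝ)⁻¹ * (‖T‖ * (C * (2 * M)) + ‖T‖ * (C * (2 * M))))
          atTop (𝓝 0) := by
        have h4 := tendsto_one_div_add_atTop_nhds_zero_nat (𝕜 := ℝ)
        simpa using h4.mul_const (‖T‖ * (C * (2 * M)) + ‖T‖ * (C * (2 * M)))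
      refine squeeze_zero_norm (fun N => ?_) (h3.mono_left hU)
      have h5 : A N (f x) - T (A N x) = ((N + 1 : ℝ)⁻¹) • (T (h (N + 1) x) - T (h 0 x)) := by
        simp only [A, hhf]
        rw [ContinuousLinearMap.map_smul_of_tower, ← smul_sub, map_sum, ← Finset.sum_sub_distrib,
          Finset.sum_range_sub (fun j => T (h j x))]
      rw [h5, norm_smul, Real.norm_of_nonneg (by positivity)]
      have h6 : ∀ j, ‖T (h j x)‖ ≤ ‖T‖ * (C * (2 * M)) := fun j =>
        (T.le_opNorm _).trans (by gcongr; exact hhb j x hx)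
      gcongr
      exact (norm_sub_le _ _).trans (add_le_add (h6 _) (h6 _))
    exact sub_eq_zero.1 (tendsto_nhds_unique h1 h2)
  · rw [ApproximatesLinearOn.approximatesLinearOn_iff_lipschitzOnWith]
    refine LipschitzOnWith.of_dist_le_mul fun x hx y hy => ?_
    have h1 : Tendsto (fun N => ‖A N x - A N y - (x - y)‖) U (𝓝 ‖Φ x - Φ y - (x - y)‖) :=
      (((hΦ x (hrD hx)).sub (hΦ y (hrD hy))).sub_const _).norm
    rw [dist_eq_norm, dist_eq_norm]
    have h2 : ‖Φ x - Φ y - (x - y)‖ ≤ 1 / 2 * ‖x - y‖ := by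
      refine le_of_tendsto h1 (Eventually.of_forall fun N => ?_)
      have h3 : A N x - A N y - (x - y) = ((N + 1 : ℝ)⁻¹) •
          ∑ j ∈ Finset.range (N + 1), (h j x - h j y - (x - y)) := by
        rw [Finset.sum_sub_distrib, Finset.sum_sub_distrib, smul_sub, smul_sub]
        congr 1
        rw [Finset.sum_const, Finset.card_range, ← Nat.cast_smul_eq_nsmul ℝ, smul_smul]
        push_cast
        rw [inv_mul_cancel₀ (by positivity), one_smul]
      rw [h3]
      exact hAle N _ _ fun j => happ j x hx y hy
    have h4 : (Φ - ⇑(ContinuousLinearMap.id ℂ E)) x - (Φ - ⇑(ContinuousLinearMap.id ℂ E)) y =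
        Φ x - Φ y - (x - y) := by
      simp only [Pi.sub_apply, ContinuousLinearMap.id_apply]; abel
    rw [h4]
    simpa using h2

/-- If the derivative of an automorphism at a fixed point `z` fixes a nonzero vector, then `z` is
not an isolated fixed point. -/
theorem exists_fixed_ne_of_fderiv_fixed [FiniteDimensional ℂ E] {D : Set E} (hD : IsOpen D)
    (hb : Bornology.IsBounded D) {f g : E → E} (hf : DifferentiableOn ℂ f D)
    (hg : DifferentiableOn ℂ g D) (hfD : MapsTo f D D) (hgD : MapsTo g D D)
    (hgf : ∀ x ∈ D, g (f x) = x) (hfg : ∀ x ∈ D, f (g x) = x) {z : E} (hz : z ∈ D)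
    (hfz : f z = z) {v : E} (hv : v ≠ 0) (hTv : fderiv ℂ f z v = v) {ε : ℝ} (hε : 0 < ε) :
    ∃ w ∈ D, f w = w ∧ w ≠ z ∧ dist w z < ε := by
  obtain ⟨Φ, hΦz, hΦf, r, hr, hrD, hΦ⟩ := exists_linearization hD hb hf hg hfD hgD hgf hfg hz hfz
  have : Nontrivial E := ⟨⟨v, 0, hv⟩⟩
  have : CompleteSpace E := FiniteDimensional.complete ℂ E
  have hΦ' : ApproximatesLinearOn Φ (ContinuousLinearEquiv.refl ℂ E : E →L[ℂ] E)
      (ball z r) (1 / 2) := hΦ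
  have hc : (1 / 2 : NNReal) < ‖((ContinuousLinearEquiv.refl ℂ E).symm : E →L[ℂ] E)‖₊⁻¹ := by
    have : ‖((ContinuousLinearEquiv.refl ℂ E).symm : E →L[ℂ] E)‖₊ = 1 :=
      ContinuousLinearMap.nnnorm_id
    rw [this, inv_one]
    exact NNReal.half_lt_self one_ne_zero
  have hinj : InjOn Φ (ball z r) := hΦ'.injOn (Or.inr hc)
  let W := ball z r ∩ ball z ε ∩ f ⁻¹' ball z r
  have hWr : W ⊆ ball z r := fun x hx => hx.1.1
  have hW : W ∈ 𝓝 z := by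
    refine inter_mem (inter_mem (ball_mem_nhds _ hr) (ball_mem_nhds _ hε)) ?_
    refine (hf.differentiableAt (hD.mem_nhds hz)).continuousAt.preimage_mem_nhds ?_
    rw [hfz]
    exact ball_mem_nhds _ hr
  have himg : Φ '' W ∈ 𝓝 (0 : E) := by
    rw [← hΦz]
    exact (hΦ'.mono_set hWr).image_mem_nhds
      (ContinuousLinearEquiv.refl ℂ E).toNonlinearRightInverse hW (Or.inr hc)
  have ht : Tendsto (fun t : ℂ => t • v) (𝓝[≠] 0) (𝓝 0) := by
    have : Tendsto (fun t : ℂ => t • v) (𝓝 0) (𝓝 ((0 : ℂ) • v)) :=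
      (continuous_id.smul continuous_const).tendsto _
    rw [zero_smul] at this
    exact this.mono_left nhdsWithin_le_nhds
  obtain ⟨t, ⟨w, hwW, hw⟩, ht0⟩ := ((ht.eventually himg).and self_mem_nhdsWithin).exists
  have hwD : w ∈ D := hrD (hWr hwW)
  refine ⟨w, hwD, hinj hwW.2 (hWr hwW) ?_, ?_, hwW.1.2⟩
  · rw [hΦf w hwD, hw, map_smul, hTv]
  · rintro rfl
    exact smul_ne_zero ht0 hv (hw.symm.trans hΦz)

/-- If `z` is an isolated fixed point of an automorphism `f`, then no real functional takes values
bounded below by a positive constant along the orbit of a vector under the derivative of `f`. -/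
theorem exists_apply_fderiv_pow_lt [FiniteDimensional ℂ E] {D : Set E} (hD : IsOpen D)
    (hb : Bornology.IsBounded D) {f g : E → E} (hf : DifferentiableOn ℂ f D)
    (hg : DifferentiableOn ℂ g D) (hfD : MapsTo f D D) (hgD : MapsTo g D D)
    (hgf : ∀ x ∈ D, g (f x) = x) (hfg : ∀ x ∈ D, f (g x) = x) {z : E} (hz : z ∈ D)
    (hfz : f z = z) {ε : ℝ} (hε : 0 < ε) (hiso : ∀ w ∈ D, f w = w → w ≠ z → ε ≤ dist w z)
    (φ : E →+ ℝ) {K : ℝ} (hφ : ∀ x, φ x ≤ K * ‖x‖) (hK : 0 ≤ K) (v : E) {c : ℝ} (hc : 0 < c) :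
    ∃ j : ℕ, φ ((fderiv ℂ f z ^ j) v) < c := by
  by_contra! hcon
  set T := fderiv ℂ f z with hT
  have hinj : Function.Injective (T - 1 : E →L[ℂ] E) := by
    rw [injective_iff_map_eq_zero]
    intro v hv
    by_contra hv0
    obtain ⟨w, hwD, hfw, hwz, hwε⟩ := exists_fixed_ne_of_fderiv_fixed hD hb hf hg hfD hgD hgf hfg
      hz hfz hv0 (sub_eq_zero.1 hv) hε
    exact absurd (hiso w hwD hfw hwz) (not_le.2 hwε)
  obtain ⟨u, rfl⟩ := (LinearMap.injective_iff_surjective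
    (f := ((T - 1 : E →L[ℂ] E) : E →ₗ[ℂ] E))).1 hinj v
  obtain ⟨C, hC0, hC⟩ := exists_norm_fderiv_pow_le hD hb hf hfD hz hfz
  obtain ⟨N, hN⟩ := exists_nat_gt (K * ((C + 1) * ‖u‖) / c)
  rw [div_lt_iff₀ hc] at hN
  have hsum : ∑ j ∈ Finset.range N, (T ^ j) ((T - 1 : E →L[ℂ] E) u) = (T ^ N) u - u := by
    have h1 : ∀ j, (T ^ j) ((T - 1 : E →L[ℂ] E) u) = (T ^ (j + 1)) u - (T ^ j) u := by
      intro j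
      rw [pow_succ]
      simp
    rw [Finset.sum_congr rfl fun j _ => h1 j, Finset.sum_range_sub (fun j => (T ^ j) u)]
    simp
  have h2 : N * c ≤ φ ((T ^ N) u - u) := by
    rw [← hsum, map_sum]
    calc (N * c : ℝ) = ∑ _j ∈ Finset.range N, c := by simp
      _ ≤ _ := Finset.sum_le_sum fun j _ => hcon j
  have h3 : ‖(T ^ N) u - u‖ ≤ (C + 1) * ‖u‖ := by
    have h4 := (T ^ N).le_of_opNorm_le (hC N) u
    exact (norm_sub_le _ _).trans (by linarith)
  have h5 := (hφ ((T ^ N) u - u)).trans (mul_le_mul_of_nonneg_left h3 hK)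
  linarith

end Linearization

section Boundary

variable {n : ℕ} {D V : Set (CSpace n)} {ρ : CSpace n → ℝ}

namespace SmoothDefiningFn

theorem differentiableAt (h : SmoothDefiningFn D V ρ) {p : CSpace n} (hp : p ∈ closure D) :
    DifferentiableAt ℝ ρ p :=
  (h.2.2.1.differentiableOn (by simp)).differentiableAt (h.1.mem_nhds (h.2.1 hp))

theorem apply_frontier (h : SmoothDefiningFn D V ρ) {p : CSpace n} (hp : p ∈ frontier D) :
    ρ p = 0 := by
  rw [h.2.2.2.2.1] at hp
  exact hp.2

theorem apply_closure_nonpos (h : SmoothDefiningFn D V ρ) {p : CSpace n} (hp : p ∈ closure D) :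
    ρ p ≤ 0 := by
  rw [closure_eq_self_union_frontier] at hp
  rcases hp with hp | hp
  · rw [h.2.2.2.1] at hp
    exact hp.2.le
  · exact (h.apply_frontier hp).le

theorem continuousAt_fderiv (h : SmoothDefiningFn D V ρ) {p : CSpace n} (hp : p ∈ closure D) :
    ContinuousAt (fderiv ℝ ρ) p :=
  (h.2.2.1.continuousOn_fderiv_of_isOpen h.1 (by simp)).continuousAt (h.1.mem_nhds (h.2.1 hp))

/-- A boundary point moves into the domain along directions of negative derivative. -/
theorem eventually_add_smul_mem (h : SmoothDefiningFn D V ρ) {p v : CSpace n}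
    (hp : p ∈ frontier D) (hv : fderiv ℝ ρ p v < 0) :
    ∀ᶠ t : ℝ in 𝓝[>] 0, p + t • v ∈ D := by
  have hpc : p ∈ closure D := frontier_subset_closure hp
  have hline : HasDerivAt (fun t : ℝ => p + t • v) v 0 := by
    simpa using ((hasDerivAt_id (0 : ℝ)).smul_const v).const_add p
  have hρ : HasFDerivAt ρ (fderiv ℝ ρ p) (p + (0 : ℝ) • v) := by
    simpa using (h.differentiableAt hpc).hasFDerivAt
  have hslope := (hρ.comp_hasDerivAt (0 : ℝ) hline).tendsto_slope_zero_right
  have hVmem : ∀ᶠ t : ℝ in 𝓝[>] 0, p + t • v ∈ V := by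
    refine (hline.continuousAt.eventually_mem ?_).filter_mono nhdsWithin_le_nhds
    simpa using h.1.mem_nhds (h.2.1 hpc)
  filter_upwards [hslope.eventually_lt_const hv, hVmem, self_mem_nhdsWithin] with t ht htV ht0
  rw [h.2.2.2.1]
  refine ⟨htV, ?_⟩
  have ht0' : (0 : ℝ) < t := ht0
  simp only [Function.comp_apply, zero_add, zero_smul, add_zero, h.apply_frontier hp, sub_zero,
    smul_eq_mul] at ht
  exact (pos_iff_neg_of_mul_neg ht).1 (inv_pos.2 ht0')

theorem exists_fderiv_eq_one (h : SmoothDefiningFn D V ρ) {p : CSpace n} (hp : p ∈ frontier D) :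
    ∃ e, fderiv ℝ ρ p e = 1 := by
  obtain ⟨e, he⟩ := DFunLike.ne_iff.1 (h.2.2.2.2.2 p hp)
  exact ⟨(fderiv ℝ ρ p e)⁻¹ • e, by rw [map_smul, smul_eq_mul, inv_mul_cancel₀ he]⟩

theorem uniqueDiffOn_closure (h : SmoothDefiningFn D V ρ) (hD : IsOpen D) :
    UniqueDiffOn ℝ (closure D) := by
  intro p hp
  by_cases hpD : p ∈ D
  · exact uniqueDiffWithinAt_of_mem_nhds (mem_of_superset (hD.mem_nhds hpD) subset_closure)
  have hpf : p ∈ frontier D := by rw [hD.frontier_eq]; exact ⟨hp, hpD⟩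
  refine ⟨?_, subset_closure hp⟩
  obtain ⟨e, he⟩ := h.exists_fderiv_eq_one hpf
  have hsub : {v | fderiv ℝ ρ p v < 0} ⊆
      (Submodule.span ℝ (tangentConeAt ℝ (closure D) p) : Set (CSpace n)) := by
    intro v hv
    refine Submodule.subset_span (mem_tangentConeAt_of_add_smul_mem (l := 𝓝[>] (0 : ℝ))
      (tendsto_id.mono_right (nhdsWithin_mono 0 fun t ht => ne_of_gt ht)) ?_)
    exact (h.eventually_add_smul_mem hpf hv).mono fun t ht => subset_closure ht
  have htop := Submodule.eq_top_of_nonempty_interior' _ ⟨-e, interior_maximal hsub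
    (isOpen_Iio.preimage (fderiv ℝ ρ p).continuous) (by simp [he])⟩
  rw [htop]
  exact dense_univ

/-- The derivative at a boundary fixed point of a self-map of the closure does not send inward
directions to outward ones. -/
theorem fderiv_apply_nonpos (h : SmoothDefiningFn D V ρ) {F : CSpace n → CSpace n}
    {p : CSpace n} (hp : p ∈ frontier D) (hF : DifferentiableWithinAt ℝ F (closure D) p)
    (hmaps : MapsTo F (closure D) (closure D)) (hFp : F p = p) {v : CSpace n}
    (hv : fderiv ℝ ρ p v < 0) :
    fderiv ℝ ρ p (fderivWithin ℝ F (closure D) p v) ≤ 0 := by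
  have hρ : HasFDerivAt ρ (fderiv ℝ ρ p) (F p) := by
    rw [hFp]
    exact (h.differentiableAt (frontier_subset_closure hp)).hasFDerivAt
  have hmax : IsLocalMaxOn (ρ ∘ F) (closure D) p := by
    refine eventually_nhdsWithin_of_forall fun x hx => ?_
    simp only [Function.comp_apply, hFp, h.apply_frontier hp]
    exact h.apply_closure_nonpos (hmaps hx)
  have hcomp := hρ.comp_hasFDerivWithinAt p hF.hasFDerivWithinAt
  exact hmax.hasFDerivWithinAt_nonpos hcomp (y := v)
    (mem_posTangentConeAt_of_frequently_mem
      ((h.eventually_add_smul_mem hp hv).mono fun t ht => subset_closure ht).frequently)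

/-- The derivative at a boundary fixed point of a diffeomorphism of the closure preserves strictly
inward directions. -/
theorem fderiv_apply_neg (h : SmoothDefiningFn D V ρ) (hD : IsOpen D)
    {f F : CSpace n → CSpace n} (hF : SmoothDiffeoExt D f F) {p : CSpace n}
    (hp : p ∈ frontier D) (hFp : F p = p) {v : CSpace n} (hv : fderiv ℝ ρ p v < 0) :
    fderiv ℝ ρ p (fderivWithin ℝ F (closure D) p v) < 0 := by
  obtain ⟨hFs, -, hFbij, G, hGs, hGF, hFG⟩ := hF
  have hpc : p ∈ closure D := frontier_subset_closure hp
  have hGp : G p = p := by simpa [hFp] using hGF p hpc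
  have hGmaps : MapsTo G (closure D) (closure D) := by
    intro z hz
    obtain ⟨x, hx, rfl⟩ := hFbij.surjOn hz
    rwa [hGF x hx]
  have hFd : DifferentiableWithinAt ℝ F (closure D) p := hFs.differentiableOn (by simp) p hpc
  have hGd : DifferentiableWithinAt ℝ G (closure D) p := hGs.differentiableOn (by simp) p hpc
  set A := fderivWithin ℝ F (closure D) p
  set B := fderivWithin ℝ G (closure D) p
  have hAB : ∀ e, A (B e) = e := by
    have h1 : HasFDerivWithinAt (F ∘ G) (A.comp B) (closure D) p :=
      HasFDerivWithinAt.comp p (by rw [hGp]; exact hFd.hasFDerivWithinAt)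
        hGd.hasFDerivWithinAt hGmaps
    have h2 : HasFDerivWithinAt (F ∘ G) (ContinuousLinearMap.id ℝ _) (closure D) p :=
      (hasFDerivWithinAt_id p _).congr (fun x hx => hFG x hx) (hFG p hpc)
    intro e
    exact DFunLike.congr_fun (((h.uniqueDiffOn_closure hD) p hpc).eq h1 h2) e
  obtain ⟨e, he⟩ := h.exists_fderiv_eq_one hp
  by_contra! hcon
  have hcont : Tendsto (fun s : ℝ => fderiv ℝ ρ p (v + s • B e)) (𝓝[>] 0)
      (𝓝 (fderiv ℝ ρ p v)) := by
    have : Continuous fun s : ℝ => fderiv ℝ ρ p (v + s • B e) := by fun_prop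
    simpa using (this.tendsto 0).mono_left nhdsWithin_le_nhds
  obtain ⟨s, hs, hs0⟩ := ((hcont.eventually_lt_const hv).and self_mem_nhdsWithin).exists
  have hs0' : (0 : ℝ) < s := hs0
  have h1 := h.fderiv_apply_nonpos hp hFd hFbij.mapsTo hFp hs
  change fderiv ℝ ρ p (A (v + s • B e)) ≤ 0 at h1
  rw [map_add, map_smul, hAB, map_add, map_smul, he, smul_eq_mul, mul_one] at h1
  linarith

end SmoothDefiningFn

/-- Near a boundary point there is a direction `v` that stays uniformly outward under the
derivatives at `z` of all elements of `H` fixing `z`. -/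
theorem exists_uniformly_outward_direction (hD : IsOpen D) (hbdry : SmoothDefiningFn D V ρ)
    (hext : ∀ f : CSpace n → CSpace n, AutOn D f →
      ∃ F : CSpace n → CSpace n, SmoothDiffeoExt D f F)
    (hconv : SmoothConvergenceProperty D)
    {H : Set (CSpace n → CSpace n)} (hH : IsCompactAutGroup D H) {p : CSpace n}
    (hp : p ∈ frontier D) :
    ∃ v : CSpace n, ∃ c > 0, ∀ z ∈ D, dist z p < c → ∀ f ∈ H, f z = z →
      c ≤ fderiv ℝ ρ z (fderiv ℝ f z v) := by
  obtain ⟨e, he⟩ := hbdry.exists_fderiv_eq_one hp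
  refine ⟨e, ?_⟩
  by_contra! hcon
  choose z hzD hzp f hfH hfz hlt using fun k : ℕ =>
    hcon (1 / ((k : ℝ) + 1)) Nat.one_div_pos_of_nat
  obtain ⟨hAut, -, -, -, hcpt⟩ := hH
  obtain ⟨φ, hφ, g, hgH, hg⟩ := hcpt f hfH
  choose F hF using fun k => hext (f (φ k)) (hAut _ (hfH _))
  obtain ⟨G, hG⟩ := hext g (hAut g hgH)
  have hlim := hconv (fun k => f (φ k)) g (fun k => hAut _ (hfH _)) (hAut g hgH) hg F G hF hG
  have hud := hbdry.uniqueDiffOn_closure hD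
  have hpc : p ∈ closure D := frontier_subset_closure hp
  have h0 : Tendsto (fun k => 1 / (((φ k : ℕ) : ℝ) + 1)) atTop (𝓝 0) :=
    (tendsto_one_div_add_atTop_nhds_zero_nat (𝕜 := ℝ)).comp hφ.tendsto_atTop
  have hz : Tendsto (fun k => z (φ k)) atTop (𝓝 p) := by
    rw [tendsto_iff_dist_tendsto_zero]
    exact squeeze_zero (fun _ => dist_nonneg) (fun k => (hzp (φ k)).le) h0
  have hz' : Tendsto (fun k => z (φ k)) atTop (𝓝[closure D] p) :=
    tendsto_nhdsWithin_iff.2 ⟨hz, Eventually.of_forall fun k => subset_closure (hzD _)⟩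
  have hj : ∀ j : ℕ, Tendsto (fun k => iteratedFDerivWithin ℝ j (F k) (closure D) (z (φ k))) atTop
      (𝓝 (iteratedFDerivWithin ℝ j G (closure D) p)) := fun j =>
    (hlim j).tendsto_comp (hG.1.continuousOn_iteratedFDerivWithin (by exact_mod_cast le_top) hud
      p hpc) hz'
  have hGp : G p = p := by
    have h1 : Tendsto (fun k => F k (z (φ k))) atTop (𝓝 (G p)) := by
      have h2 := ((ContinuousMultilinearMap.apply ℝ (fun _ : Fin 0 => CSpace n) (CSpace n)
        0).continuous.tendsto _).comp (hj 0)
      simpa [Function.comp_def, iteratedFDerivWithin_zero_apply] using h2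
    refine tendsto_nhds_unique h1 (hz.congr fun k => ?_)
    rw [(hF k).2.1 (hzD _), hfz]
  have hder : Tendsto (fun k => fderiv ℝ (f (φ k)) (z (φ k)) e) atTop
      (𝓝 (fderivWithin ℝ G (closure D) p e)) := by
    have h2 := ((ContinuousMultilinearMap.apply ℝ (fun _ : Fin 1 => CSpace n) (CSpace n)
      fun _ => e).continuous.tendsto _).comp (hj 1)
    simp only [ContinuousMultilinearMap.apply_apply,
      iteratedFDerivWithin_one_apply (hud p hpc)] at h2
    refine h2.congr fun k => ?_
    have hzn := hD.mem_nhds (hzD (φ k))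
    simp only [Function.comp_apply, ContinuousMultilinearMap.apply_apply]
    rw [iteratedFDerivWithin_one_apply (hud _ (subset_closure (hzD _))),
      fderivWithin_of_mem_nhds (mem_of_superset hzn subset_closure),
      (((hF k).2.1.eventuallyEq_of_mem hzn)).fderiv_eq]
  have hfin : Tendsto (fun k => fderiv ℝ ρ (z (φ k)) (fderiv ℝ (f (φ k)) (z (φ k)) e)) atTop
      (𝓝 (fderiv ℝ ρ p (fderivWithin ℝ G (closure D) p e))) :=
    (isBoundedBilinearMap_apply.continuous.tendsto
      (fderiv ℝ ρ p, fderivWithin ℝ G (closure D) p e)).comp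
      (((hbdry.continuousAt_fderiv hpc).tendsto.comp hz).prodMk_nhds hder)
  have hle := le_of_tendsto_of_tendsto hfin h0 (Eventually.of_forall fun k => (hlt (φ k)).le)
  have hneg := hbdry.fderiv_apply_neg hD hG hp hGp (v := -e) (by rw [map_neg, he]; norm_num)
  rw [map_neg, map_neg] at hneg
  linarith

/-- Iterates of an element of `H` agree on `D` with elements of `H`. -/
theorem IsCompactAutGroup.exists_eqOn_iterate {H : Set (CSpace n → CSpace n)}
    (hH : IsCompactAutGroup D H) {f : CSpace n → CSpace n} (hf : f ∈ H) (j : ℕ) :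
    ∃ h ∈ H, EqOn h f^[j] D := by
  obtain ⟨hAut, ⟨e, heH, he⟩, hmul, -⟩ := hH
  induction j with
  | zero => exact ⟨e, heH, he⟩
  | succ j ih =>
    obtain ⟨h, hhH, hh⟩ := ih
    obtain ⟨k, hkH, hk⟩ := hmul f hf h hhH
    refine ⟨k, hkH, fun z hz => ?_⟩
    rw [hk z hz, hh hz, Function.iterate_succ_apply']

end Boundary

theorem fixed_points_in_compact_set {n : ℕ} (D V : Set (CSpace n)) (ρ : CSpace n → ℝ)
    (hDopen : IsOpen D) (hDconn : IsConnected D) (hDbdd : Bornology.IsBounded D)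
    (hbdry : SmoothDefiningFn D V ρ)
    (hext : ∀ f : CSpace n → CSpace n, AutOn D f →
      ∃ F : CSpace n → CSpace n, SmoothDiffeoExt D f F)
    (hconv : SmoothConvergenceProperty D)
    (H : Set (CSpace n → CSpace n)) (hH : IsCompactAutGroup D H) :
    ∃ K : Set (CSpace n), K ⊆ D ∧ IsCompact K ∧
      ∀ f ∈ H, DiscreteIn (FixOn D f) → FixOn D f ⊆ K := by
  refine ⟨closure (⋃ f ∈ {f ∈ H | DiscreteIn (FixOn D f)}, FixOn D f), ?_, ?_, ?_⟩
  · intro p hp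
    by_contra hpD
    have hsub : (⋃ f ∈ {f ∈ H | DiscreteIn (FixOn D f)}, FixOn D f) ⊆ D :=
      iUnion₂_subset fun f _ z hz => hz.1
    have hpf : p ∈ frontier D := by
      rw [hDopen.frontier_eq]
      exact ⟨closure_mono hsub hp, hpD⟩
    obtain ⟨v, c, hc, hv⟩ := exists_uniformly_outward_direction hDopen hbdry hext hconv hH hpf
    obtain ⟨z, hzB, hzp⟩ := Metric.mem_closure_iff.1 hp c hc
    rw [dist_comm] at hzp
    obtain ⟨f, ⟨hfH, hdisc⟩, hzD, hfz⟩ := mem_iUnion₂.1 hzB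
    obtain ⟨ε, hε, hiso⟩ := hdisc z ⟨hzD, hfz⟩
    obtain ⟨hfd, hfbij, g, hgd, hgbij, hgf, hfg⟩ := hH.1 f hfH
    obtain ⟨j, hj⟩ := exists_apply_fderiv_pow_lt hDopen hDbdd hfd hgd hfbij.mapsTo hgbij.mapsTo
      hgf hfg hzD hfz hε (fun w hwD hfw => hiso w ⟨hwD, hfw⟩)
      ((fderiv ℝ ρ z : CSpace n →ₗ[ℝ] ℝ) : CSpace n →+ ℝ) (K := ‖fderiv ℝ ρ z‖)
      (fun x => (le_abs_self _).trans ((fderiv ℝ ρ z).le_opNorm x)) (norm_nonneg _) v hc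
    obtain ⟨h, hhH, hh⟩ := hH.exists_eqOn_iterate hfH j
    have hzn := hDopen.mem_nhds hzD
    have hder : HasFDerivAt h (fderiv ℂ f z ^ j) z :=
      ((hfd.differentiableAt hzn).hasFDerivAt.iterate hfz j).congr_of_eventuallyEq
        (hh.eventuallyEq_of_mem hzn)
    have hle := hv z hzD hzp h hhH (by rw [hh hzD, Function.iterate_fixed hfz])
    rw [(hder.restrictScalars ℝ).fderiv] at hle
    exact absurd hle (not_le.2 hj)
  · exact (hDbdd.subset (iUnion₂_subset fun f _ z hz => hz.1)).isCompact_closure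
  · intro f hfH hdisc
    exact (subset_biUnion_of_mem (u := fun f => FixOn D f)
      (show f ∈ {f ∈ H | DiscreteIn (FixOn D f)} from ⟨hfH, hdisc⟩)).trans subset_closure
end
end

section
/- Let U ⊆ ℂ^n be open, let f : U → ℂ^n be holomorphic, and let z₀ ∈ U and r > 0 be such that the closed ball of center z₀ and radius r is contained in U, z₀ is the only fixed point of f in this closed ball (f(z₀) = z₀ and f(z) ≠ z for all other z in the closed ball), and 1 is not an eigenvalue of the complex derivative df(z₀). Let g : U → ℂ^n be holomorphic with ‖g(z) − f(z)‖ < ‖f(z) − z‖ for every z on the sphere of center z₀ and radius r. Then g has exactly one fixed point in the open ball B(z₀, r); in particular g cannot have two distinct fixed points there. -/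
open Set Metric Filter Topology

noncomputable section

/-- A directional derivative of a holomorphic map between finite-dimensional spaces is
holomorphic. -/
theorem differentiableOn_fderiv_apply {E G : Type*} [NormedAddCommGroup E]
    [NormedSpace ℂ E] [FiniteDimensional ℂ E] [NormedAddCommGroup G] [NormedSpace ℂ G]
    [FiniteDimensional ℂ G] {f : E → G} {U : Set E} (hU : IsOpen U)
    (hf : DifferentiableOn ℂ f U) (v : E) :
    DifferentiableOn ℂ (fun z => fderiv ℂ f z v) U := by
  borelize E
  borelize (E →L[ℂ] G)
  have : CompleteSpace G := FiniteDimensional.complete ℂ G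
  have : ProperSpace (E →L[ℂ] G) := FiniteDimensional.proper ℂ _
  intro z₀ hz₀
  have hdiff : ∀ z ∈ U, DifferentiableAt ℂ f z := fun z hz => hf.differentiableAt (hU.mem_nhds hz)
  obtain ⟨ρ, hρ, hρU⟩ : ∃ ρ > 0, ball z₀ (4 * ρ) ⊆ U ∩ f ⁻¹' ball (f z₀) 1 := by
    have h : U ∩ f ⁻¹' ball (f z₀) 1 ∈ 𝓝 z₀ :=
      inter_mem (hU.mem_nhds hz₀)
        ((hdiff z₀ hz₀).continuousAt.preimage_mem_nhds (ball_mem_nhds _ one_pos))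
    obtain ⟨ρ, hρ, h⟩ := Metric.mem_nhds_iff.1 h
    exact ⟨ρ / 4, by positivity, by convert h using 2; ring⟩
  have hbound : ∀ w ∈ ball z₀ (2 * ρ), ‖fderiv ℂ f w‖ ≤ 2 / (2 * ρ) := by
    intro w hw
    have hsub : ball w (2 * ρ) ⊆ ball z₀ (4 * ρ) :=
      ball_subset_ball' (by rw [mem_ball] at hw; linarith)
    refine Complex.norm_fderiv_le_div_of_mapsTo_ball
      (hf.mono fun x hx => (hρU (hsub hx)).1) (fun x hx => ?_) (by positivity)
    have h1 := (hρU (hsub hx)).2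
    have h2 := (hρU (hsub (mem_ball_self (by positivity : 0 < 2 * ρ)))).2
    simp only [mem_preimage, mem_ball] at h1 h2
    rw [mem_closedBall]
    linarith [dist_triangle_right (f x) (f w) (f z₀)]
  set R : ℝ := ρ / (‖v‖ + 1) with hR
  have hRpos : 0 < R := by positivity
  have hRv : R * ‖v‖ < ρ := by
    rw [hR, div_mul_eq_mul_div, div_lt_iff₀ (by positivity)]
    nlinarith [norm_nonneg v]
  have hmem : ∀ z ∈ ball z₀ ρ, ∀ ζ : ℂ, ‖ζ‖ ≤ R → z + ζ • v ∈ ball z₀ (2 * ρ) := by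
    intro z hz ζ hζ
    rw [mem_ball, dist_eq_norm] at hz ⊢
    calc ‖z + ζ • v - z₀‖ = ‖(z - z₀) + ζ • v‖ := by congr 1; abel
      _ ≤ ‖z - z₀‖ + ‖ζ‖ * ‖v‖ := (norm_add_le _ _).trans (by rw [norm_smul])
      _ ≤ ‖z - z₀‖ + R * ‖v‖ := by gcongr
      _ < 2 * ρ := by linarith
  have hball : ∀ z ∈ ball z₀ (2 * ρ), z ∈ U := fun z hz =>
    (hρU (ball_subset_ball (by linarith) hz)).1
  have hcirc : ∀ θ, ‖circleMap 0 R θ‖ ≤ R := fun θ => by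
    simp [abs_of_pos hRpos]
  let c : ℝ → ℂ := fun θ => deriv (circleMap 0 R) θ * (1 / (circleMap 0 R θ - 0) ^ 2)
  have hc : Continuous c := by
    simp only [c, deriv_circleMap, sub_zero]
    refine .mul (by fun_prop) (.div₀ (by fun_prop) (by fun_prop) fun θ => ?_)
    exact pow_ne_zero _ (circleMap_ne_center hRpos.ne')
  have hrep : ∀ z ∈ ball z₀ ρ, fderiv ℂ f z v =
      (2 * Real.pi * Complex.I : ℂ)⁻¹ •
        ∫ θ in (0 : ℝ)..2 * Real.pi, c θ • f (z + circleMap 0 R θ • v) := by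
    intro z hz
    have hline : ∀ ζ : ℂ, HasDerivAt (fun ζ : ℂ => z + ζ • v) v ζ := fun ζ => by
      simpa using ((hasDerivAt_id ζ).smul_const v).const_add z
    have hd : DifferentiableOn ℂ (fun ζ : ℂ => f (z + ζ • v)) (closedBall 0 R) := by
      intro ζ hζ
      have := hmem z hz ζ (by simpa using hζ)
      exact ((hdiff _ (hball _ this)).comp ζ
        (hline ζ).differentiableAt).differentiableWithinAt
    have h := hd.deriv_eq_smul_circleIntegral hRpos
    have hder : deriv (fun ζ : ℂ => f (z + ζ • v)) 0 = fderiv ℂ f z v := by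
      have h0 : HasFDerivAt f (fderiv ℂ f z) (z + (0 : ℂ) • v) := by
        simpa using (hdiff z (hball z (by simpa using hmem z hz 0 (by simpa using hRpos.le)))).hasFDerivAt
      exact (h0.comp_hasDerivAt (0 : ℂ) (hline 0)).deriv
    rw [hder, circleIntegral] at h
    simp only [smul_smul] at h
    simp only [c]
    rw [h, smul_smul, inv_mul_cancel₀ Complex.two_pi_I_ne_zero, one_smul]
  have hcont : ∀ z ∈ ball z₀ ρ, Continuous fun θ => c θ • f (z + circleMap 0 R θ • v) := by
    intro z hz
    refine hc.smul (continuous_iff_continuousAt.2 fun θ => ?_)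
    exact ContinuousAt.comp (f := fun θ => z + circleMap 0 R θ • v)
      (hdiff _ (hball _ (hmem z hz _ (hcirc θ)))).continuousAt (by fun_prop)
  have hz₀ρ : z₀ ∈ ball z₀ ρ := mem_ball_self hρ
  have key := intervalIntegral.hasFDerivAt_integral_of_dominated_of_fderiv_le (𝕜 := ℂ)
    (μ := MeasureTheory.volume) (a := 0) (b := 2 * Real.pi) (s := ball z₀ ρ) (x₀ := z₀)
    (F := fun z θ => c θ • f (z + circleMap 0 R θ • v))
    (F' := fun z θ => c θ • fderiv ℂ f (z + circleMap 0 R θ • v))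
    (bound := fun θ => ‖c θ‖ * (2 / (2 * ρ)))
    (ball_mem_nhds z₀ hρ)
    (eventually_of_mem (ball_mem_nhds z₀ hρ) fun z hz => (hcont z hz).aestronglyMeasurable)
    ((hcont z₀ hz₀ρ).intervalIntegrable _ _)
    (hc.aestronglyMeasurable.smul ((measurable_fderiv ℂ f).comp
      (Continuous.measurable (by fun_prop))).aestronglyMeasurable)
    (.of_forall fun θ _ z hz => by
      rw [norm_smul]
      exact mul_le_mul_of_nonneg_left (hbound _ (hmem z hz _ (hcirc θ))) (norm_nonneg _))
    ((hc.norm.mul continuous_const).intervalIntegrable _ _)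
    (.of_forall fun θ _ z hz => by
      refine HasFDerivAt.const_smul ?_ _
      exact (hasFDerivAt_comp_add_right _).2
        (hdiff _ (hball _ (hmem z hz _ (hcirc θ)))).hasFDerivAt)
  refine (DifferentiableAt.congr_of_eventuallyEq (key.differentiableAt.const_smul _)
    (eventually_of_mem (ball_mem_nhds z₀ hρ) hrep)).differentiableWithinAt

/-- A holomorphic map between finite-dimensional spaces is smooth. -/
theorem contDiffOn_of_differentiableOn_complex {E G : Type*} [NormedAddCommGroup E]
    [NormedSpace ℂ E] [FiniteDimensional ℂ E] [NormedAddCommGroup G] [NormedSpace ℂ G]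
    [FiniteDimensional ℂ G] {U : Set E} (hU : IsOpen U) (n : ℕ) {f : E → G}
    (hf : DifferentiableOn ℂ f U) : ContDiffOn ℂ n f U := by
  induction n generalizing f with
  | zero => exact contDiffOn_zero.2 hf.continuousOn
  | succ n ih =>
    push_cast
    refine (contDiffOn_succ_iff_fderiv_of_isOpen hU).2 ⟨hf, by simp, ?_⟩
    exact contDiffOn_clm_apply.2 fun v => ih (differentiableOn_fderiv_apply hU hf v)

/-- The determinant on `ℝ^m`, as a continuous alternating form. -/
def detForm (m : ℕ) : (Fin m → ℝ) [⋀^Fin m]→L[ℝ] ℝ :=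
  { (Matrix.detRowAlternating : (Fin m → ℝ) [⋀^Fin m]→ₗ[ℝ] ℝ) with
    cont := Continuous.matrix_det continuous_id }

theorem detForm_apply_single {m : ℕ} (A : (Fin m → ℝ) →L[ℝ] (Fin m → ℝ)) :
    detForm m (fun j => A (Pi.single j 1)) = A.det := by
  change Matrix.det (Matrix.of fun j => A (Pi.single j 1)) = _
  rw [← Matrix.det_transpose, ContinuousLinearMap.det, ← LinearMap.det_toMatrix']
  congr 1

theorem continuousAlternatingMap_succ_eq_zero {m : ℕ} (η : (Fin m → ℝ) [⋀^Fin (m + 1)]→L[ℝ] ℝ) :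
    η = 0 := by
  ext v
  refine η.toAlternatingMap.map_linearDependent v fun h => ?_
  have := h.fintype_card_le_finrank
  simp at this

/-- The pullback of a top-degree form `φ • det` on `ℝ^m` under a `C^2` map is closed. -/
theorem extDeriv_pullback_smul_detForm {m : ℕ} {V : Type*} [NormedAddCommGroup V]
    [NormedSpace ℝ V] {φ : (Fin m → ℝ) → ℝ} (hφ : Differentiable ℝ φ) {H : V → Fin m → ℝ} {x : V}
    (hH : ContDiffAt ℝ 2 H x) :
    extDeriv (fun y => (φ (H y) • detForm m).compContinuousLinearMap (fderiv ℝ H y)) x = 0 := by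
  have h := extDeriv_pullback (ω := fun w => φ w • detForm m) (f := H) (x := x)
    ((hφ _).smul_const _) hH (by simp)
  rw [h, continuousAlternatingMap_succ_eq_zero (extDeriv _ _)]
  ext; simp

theorem differentiableAt_pullback_smul_detForm {m : ℕ} {V : Type*} [NormedAddCommGroup V]
    [NormedSpace ℝ V] {φ : (Fin m → ℝ) → ℝ} (hφ : Differentiable ℝ φ) {H : V → Fin m → ℝ} {x : V}
    (hH : ContDiffAt ℝ 2 H x) :
    DifferentiableAt ℝ
      (fun y => (φ (H y) • detForm m).compContinuousLinearMap (fderiv ℝ H y)) x := by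
  refine DifferentiableAt.continuousAlternatingMapCompContinuousLinearMap ?_ ?_
  · exact ((hφ _).comp x (hH.differentiableAt (by simp))).smul_const _
  · exact (hH.fderiv_right (m := 1) (by norm_num)).differentiableAt (by simp)

/-- Flux conservation for closed forms: a closed `m`-form on `[0, 1] × ℝ^m` which is supported in
`[0, 1] × K` with `K` bounded has the same integral over `{0} × ℝ^m` and `{1} × ℝ^m`. -/
theorem integral_face_eq_of_extDeriv_eq_zero {m : ℕ} {K : Set (Fin m → ℝ)}
    (hK : Bornology.IsBounded K)
    {ω : (Fin (m + 1) → ℝ) → (Fin (m + 1) → ℝ) [⋀^Fin m]→L[ℝ] ℝ}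
    (hsupp : ∀ x, x 0 ∈ Icc (0 : ℝ) 1 → Fin.tail (α := fun _ => ℝ) x ∉ K → ω x = 0)
    (hdiff : ∀ x, x 0 ∈ Icc (0 : ℝ) 1 → DifferentiableAt ℝ ω x)
    (hclosed : ∀ x, x 0 ∈ Icc (0 : ℝ) 1 → extDeriv ω x = 0) :
    ∫ z, ω (Fin.cons 0 z) (fun j => Pi.single j.succ 1) =
      ∫ z, ω (Fin.cons 1 z) (fun j => Pi.single j.succ 1) := by
  obtain ⟨R, hRpos, hR⟩ : ∃ R > 0, ∀ z ∈ K, ‖z‖ < R := by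
    obtain ⟨R, hR⟩ := hK.exists_norm_le
    exact ⟨|R| + 1, by positivity, fun z hz => by linarith [hR z hz, le_abs_self R]⟩
  let e : Fin (m + 1) → Fin (m + 1) → ℝ := fun i => Pi.single i 1
  let a : Fin (m + 1) → ℝ := Fin.cons 0 fun _ => -R
  let b : Fin (m + 1) → ℝ := Fin.cons 1 fun _ => R
  have hab : a ≤ b := by
    intro i
    refine Fin.cases ?_ (fun i => ?_) i <;> simp [a, b]
    linarith
  let F : Fin (m + 1) → (Fin (m + 1) → ℝ) → ℝ :=
    fun i x => (-1) ^ i.val * ω x (i.removeNth e)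
  have hF : ∀ x, x 0 ∈ Icc (0 : ℝ) 1 → ∀ i, DifferentiableAt ℝ (F i) x := fun x hx i =>
    ((hdiff x hx).continuousAlternatingMap_apply_const _).const_mul _
  have h0 : ∀ x ∈ Icc a b, x 0 ∈ Icc (0 : ℝ) 1 := fun x hx => by
    simpa [a, b] using And.intro (hx.1 0) (hx.2 0)
  have hdiv : ∀ x, x 0 ∈ Icc (0 : ℝ) 1 → ∑ i, fderiv ℝ (F i) x (Pi.single i 1) = 0 := by
    intro x hx
    have h := extDeriv_apply (hdiff x hx) e
    rw [hclosed x hx] at h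
    replace h := (show (0 : ℝ) = _ from h)
    rw [h]
    refine Finset.sum_congr rfl fun i _ => ?_
    have : fderiv ℝ (F i) x = (-1 : ℝ) ^ i.val • fderiv ℝ (fun y => ω y (i.removeNth e)) x :=
      fderiv_const_mul ((hdiff x hx).continuousAlternatingMap_apply_const _) _
    rw [this]
    simp [e]
  have hdivthm := MeasureTheory.integral_divergence_of_hasFDerivAt_off_countable' a b hab F
    (fun i => fderiv ℝ (F i)) ∅ countable_empty
    (fun i x hx => (hF x (h0 x hx) i).continuousAt.continuousWithinAt)
    (fun x hx i => (hF x (by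
      have := hx.1 0 (mem_univ _)
      simp only [a, b, Fin.cons_zero] at this
      exact Ioo_subset_Icc_self this) i).hasFDerivAt)
    ((MeasureTheory.integrableOn_congr_fun (g := 0) (fun x hx => hdiv x (h0 x hx))
      measurableSet_Icc).2 MeasureTheory.integrableOn_zero)
  rw [MeasureTheory.setIntegral_congr_fun (g := 0) measurableSet_Icc
    (fun x hx => hdiv x (h0 x hx))] at hdivthm
  simp only [Pi.zero_apply, MeasureTheory.integral_zero] at hdivthm
  rw [Fin.sum_univ_succ] at hdivthm
  have hside : ∀ i : Fin m, ∀ s : ℝ, |s| = R → ∀ x ∈ Icc (a ∘ i.succ.succAbove) (b ∘ i.succ.succAbove),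
      F i.succ (i.succ.insertNth s x) = 0 := by
    intro i s hs x hx
    have hx0 : (i.succ.insertNth s x : Fin (m + 1) → ℝ) 0 ∈ Icc (0 : ℝ) 1 := by
      obtain ⟨k, rfl⟩ : ∃ k, m = k + 1 := ⟨m - 1, by have := i.2; omega⟩
      have e1 : (0 : Fin (k + 2)) = i.succ.succAbove 0 := by
        rw [Fin.succ_succAbove_zero]
      rw [e1, Fin.insertNth_apply_succAbove]
      have h1 := hx.1 0
      have h2 := hx.2 0
      simp only [Function.comp_apply, ← e1] at h1 h2
      exact ⟨by simpa [a] using h1, by simpa [b] using h2⟩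
    have hxK : Fin.tail (α := fun _ => ℝ) (i.succ.insertNth s x) ∉ K := by
      intro hmem
      have h1 := hR _ hmem
      have h2 := norm_le_pi_norm (Fin.tail (α := fun _ => ℝ) (i.succ.insertNth s x)) i
      simp only [Fin.tail, Fin.insertNth_apply_same, Real.norm_eq_abs, hs] at h2
      exact absurd h1 (not_lt.2 h2)
    simp only [F]
    rw [hsupp _ hx0 hxK]
    simp
  have hzero : ∀ i : Fin m, (∫ x in Icc (a ∘ i.succ.succAbove) (b ∘ i.succ.succAbove),
        F i.succ (i.succ.insertNth (b i.succ) x)) -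
      ∫ x in Icc (a ∘ i.succ.succAbove) (b ∘ i.succ.succAbove),
        F i.succ (i.succ.insertNth (a i.succ) x) = 0 := by
    intro i
    rw [MeasureTheory.setIntegral_eq_zero_of_forall_eq_zero
        (hside i _ (by simp [b, abs_of_pos hRpos])),
      MeasureTheory.setIntegral_eq_zero_of_forall_eq_zero
        (hside i _ (by simp [a, abs_of_pos hRpos])), sub_zero]
  rw [Finset.sum_eq_zero fun i _ => hzero i, add_zero] at hdivthm
  have hface : ∀ s ∈ Icc (0 : ℝ) 1,
      ∫ x in Icc (a ∘ (0 : Fin (m + 1)).succAbove) (b ∘ (0 : Fin (m + 1)).succAbove),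
        F 0 ((0 : Fin (m + 1)).insertNth s x) =
      ∫ z, ω (Fin.cons s z) (fun j => Pi.single j.succ 1) := by
    intro s hs
    rw [MeasureTheory.setIntegral_eq_integral_of_forall_compl_eq_zero]
    · refine MeasureTheory.integral_congr_ae (.of_forall fun z => ?_)
      simp only [F, Fin.insertNth_zero']
      simp [e, Fin.removeNth_zero, Fin.tail_def]
    · intro z hz
      have hzK : z ∉ K := by
        intro hzK
        refine hz ?_
        have := hR z hzK
        rw [pi_norm_lt_iff hRpos] at this
        constructor <;> intro i <;> have := abs_lt.1 (this i) <;> simp [a, b] <;> linarith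
      simp only [F, Fin.insertNth_zero']
      rw [hsupp _ (by simpa using hs) (by simpa using hzK)]
      simp
  rw [hface _ (by simp [b]), hface _ (by simp [a])] at hdivthm
  simp only [a, b, Fin.cons_zero] at hdivthm
  linarith

/-- Homotopy invariance of the degree integral along the straight-line homotopy. -/
theorem setIntegral_comp_mul_det_eq_of_homotopy {m : ℕ} {K Ω : Set (Fin m → ℝ)} (hK : IsCompact K)
    (hΩ : IsOpen Ω) (hKΩ : K ⊆ Ω) {F G : (Fin m → ℝ) → Fin m → ℝ} (hF : ContDiffOn ℝ 2 F Ω)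
    (hG : ContDiffOn ℝ 2 G Ω) {φ : (Fin m → ℝ) → ℝ} (hφ : Differentiable ℝ φ)
    (hbdry : ∀ t ∈ Icc (0 : ℝ) 1, ∀ z ∈ frontier K, F z + t • (G z - F z) ∉ tsupport φ) :
    ∫ z in K, φ (F z) * (fderiv ℝ F z).det = ∫ z in K, φ (G z) * (fderiv ℝ G z).det := by
  let τ : (Fin (m + 1) → ℝ) → Fin m → ℝ := fun x => Fin.tail (α := fun _ => ℝ) x
  have hτ : ContDiff ℝ 2 τ := contDiff_pi.2 fun i => contDiff_apply ℝ ℝ i.succ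
  let H : (Fin (m + 1) → ℝ) → Fin m → ℝ := fun x => F (τ x) + x 0 • (G (τ x) - F (τ x))
  have hH : ∀ x, τ x ∈ Ω → ContDiffAt ℝ 2 H x := by
    intro x hx
    have h1 := (hF.contDiffAt (hΩ.mem_nhds hx)).comp x hτ.contDiffAt
    have h2 := (hG.contDiffAt (hΩ.mem_nhds hx)).comp x hτ.contDiffAt
    exact h1.add ((contDiff_apply ℝ ℝ 0).contDiffAt.smul (h2.sub h1))
  let η := fun y => (φ (H y) • detForm m).compContinuousLinearMap (fderiv ℝ H y)
  let ω := (τ ⁻¹' K).indicator η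
  have hloc : ∀ x, x 0 ∈ Icc (0 : ℝ) 1 → (τ x ∈ Ω ∧ ω =ᶠ[𝓝 x] η) ∨ ω =ᶠ[𝓝 x] 0 := by
    intro x hx
    by_cases hxK : τ x ∈ K
    · by_cases hxi : τ x ∈ interior K
      · left
        refine ⟨hKΩ hxK, ?_⟩
        filter_upwards [hτ.continuous.continuousAt.preimage_mem_nhds
          (isOpen_interior.mem_nhds hxi)] with y hy
        exact indicator_of_mem (s := τ ⁻¹' K) (f := η)
          (show y ∈ τ ⁻¹' K from interior_subset (s := K) hy)
      · right
        have hn := hbdry (x 0) hx (τ x) ⟨subset_closure hxK, hxi⟩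
        filter_upwards [(hH x (hKΩ hxK)).continuousAt.preimage_mem_nhds
          ((isClosed_tsupport φ).isOpen_compl.mem_nhds hn)] with y hy
        have hy0 : φ (H y) = 0 := image_eq_zero_of_notMem_tsupport hy
        have hη : η y = 0 := by
          ext v
          simp [η, hy0]
        exact (indicator_apply_eq_zero (s := τ ⁻¹' K) (f := η)).2 fun _ => hη
    · right
      filter_upwards [hτ.continuous.continuousAt.preimage_mem_nhds
          (hK.isClosed.isOpen_compl.mem_nhds hxK)] with y hy
      exact indicator_of_notMem (s := τ ⁻¹' K) (f := η) hy
  have key := integral_face_eq_of_extDeriv_eq_zero hK.isBounded (ω := ω)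
    (fun x _ hx => indicator_of_notMem (by exact hx) _)
    (fun x hx => by
      rcases hloc x hx with ⟨hx', h⟩ | h
      · exact (differentiableAt_pullback_smul_detForm hφ (hH x hx')).congr_of_eventuallyEq h
      · exact (differentiableAt_const _).congr_of_eventuallyEq h)
    (fun x hx => by
      rcases hloc x hx with ⟨hx', h⟩ | h
      · rw [h.extDeriv_eq]
        exact extDeriv_pullback_smul_detForm hφ (hH x hx')
      · rw [h.extDeriv_eq, extDeriv, fderiv_zero]
        ext v
        simp [ContinuousAlternatingMap.alternatizeUncurryFin_apply])
  have hface : ∀ (s : ℝ) (Φ : (Fin m → ℝ) → Fin m → ℝ), (∀ z, H (Fin.cons s z) = Φ z) →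
      ∫ z, ω (Fin.cons s z) (fun j => Pi.single j.succ 1) =
        ∫ z in K, φ (Φ z) * (fderiv ℝ Φ z).det := by
    intro s Φ hΦ
    rw [← MeasureTheory.integral_indicator hK.measurableSet]
    refine MeasureTheory.integral_congr_ae (.of_forall fun z => ?_)
    have hτz : τ (Fin.cons s z) = z := Fin.tail_cons (α := fun _ => ℝ) s z
    by_cases hz : z ∈ K
    · have hc : HasFDerivAt (fun z : Fin m → ℝ => (Fin.cons s z : Fin (m + 1) → ℝ))
          (ContinuousLinearMap.pi (Fin.cons 0 fun j =>
            ContinuousLinearMap.proj (R := ℝ) (φ := fun _ : Fin m => ℝ) j)) z := by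
        refine hasFDerivAt_pi.2 fun i => ?_
        refine Fin.cases ?_ (fun i => ?_) i
        · simpa using hasFDerivAt_const s z
        · simpa using hasFDerivAt_apply (𝕜 := ℝ) (F' := fun _ : Fin m => ℝ) i z
      have hd : HasFDerivAt H (fderiv ℝ H (Fin.cons s z)) (Fin.cons s z) :=
        ((hH _ (hτz ▸ hKΩ hz)).differentiableAt (by simp)).hasFDerivAt
      have hcomp := hd.comp z hc
      have hΦd : fderiv ℝ Φ z = _ := (hcomp.congr_of_eventuallyEq
        (.of_forall fun y => (hΦ y).symm)).fderiv
      rw [indicator_of_mem hz]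
      simp only [ω]
      rw [indicator_of_mem (by exact hτz.symm ▸ hz)]
      simp only [η, hΦ]
      rw [← detForm_apply_single, hΦd]
      change φ (Φ z) * detForm m _ = _
      congr 2
      ext j : 1
      change fderiv ℝ H (Fin.cons s z) _ = fderiv ℝ H (Fin.cons s z) _
      congr 1
      ext i
      refine Fin.cases ?_ (fun i => ?_) i
      · simp
      · simp [Pi.single_apply]
    · rw [indicator_of_notMem hz]
      simp only [ω]
      rw [indicator_of_notMem (by exact fun h => hz (hτz ▸ h))]
      rfl
  rw [← hface 0 F fun z => ?_, ← hface 1 G fun z => ?_, key]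
  · simp [H, τ]
  · simp [H, τ]

section LocalCount

variable {W : Type*} [NormedAddCommGroup W] [NormedSpace ℝ W] [FiniteDimensional ℝ W]
  [MeasurableSpace W] [BorelSpace W] {μ : MeasureTheory.Measure W} [μ.IsAddHaarMeasure]

/-- Near a nondegenerate zero, the degree integral of a test function supported close to the origin
counts the zero once. -/
theorem exists_nhds_setIntegral_comp_mul_det_eq {F : W → W} {Ω : Set W} (hΩ : IsOpen Ω)
    (hF : ContDiffOn ℝ 2 F Ω) {a : W} (ha : F a = 0) (hdet : (fderiv ℝ F a).det ≠ 0)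
    {N : Set W} (hN : N ∈ 𝓝 a) (hNΩ : N ⊆ Ω) (hpos : ∀ z ∈ N, 0 ≤ (fderiv ℝ F z).det) :
    ∃ N' ⊆ N, IsOpen N' ∧ a ∈ N' ∧ ∃ ε > 0, ∀ φ : W → ℝ, Function.support φ ⊆ ball 0 ε →
      ∫ z in N', φ (F z) * (fderiv ℝ F z).det ∂μ = ∫ w, φ w ∂μ := by
  have hFa : ContDiffAt ℝ 2 F a := hF.contDiffAt (hΩ.mem_nhds (hNΩ (mem_of_mem_nhds hN)))
  have hFd : HasFDerivAt F
      ((fderiv ℝ F a).toContinuousLinearEquivOfDetNeZero hdet : W →L[ℝ] W) a := by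
    rw [ContinuousLinearMap.coe_toContinuousLinearEquivOfDetNeZero]
    exact (hFa.differentiableAt (by simp)).hasFDerivAt
  have : CompleteSpace W := FiniteDimensional.complete ℝ W
  let Φ := hFa.toOpenPartialHomeomorph F hFd (by simp)
  have hΦ : ∀ z, Φ z = F z := fun z => rfl
  have haΦ : a ∈ Φ.source := hFa.mem_toOpenPartialHomeomorph_source hFd (by simp)
  refine ⟨Φ.source ∩ interior N, fun z hz => interior_subset hz.2,
    Φ.open_source.inter isOpen_interior, ⟨haΦ, mem_interior_iff_mem_nhds.2 hN⟩, ?_⟩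
  set N' := Φ.source ∩ interior N
  have hN'o : IsOpen N' := Φ.open_source.inter isOpen_interior
  have himg : IsOpen (F '' N') := Φ.isOpen_image_of_subset_source hN'o inter_subset_left
  have h0 : (0 : W) ∈ F '' N' := ⟨a, ⟨haΦ, mem_interior_iff_mem_nhds.2 hN⟩, ha⟩
  obtain ⟨ε, hε, hsub⟩ := Metric.isOpen_iff.1 himg 0 h0
  refine ⟨ε, hε, fun φ hφ => ?_⟩
  have hcov := MeasureTheory.integral_image_eq_integral_abs_det_fderiv_smul μ hN'o.measurableSet
    (f := F) (f' := fderiv ℝ F) (fun z hz => ((hF.contDiffAt (hΩ.mem_nhds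
      (hNΩ (interior_subset hz.2)))).differentiableAt (by simp)).hasFDerivAt.hasFDerivWithinAt)
    (Φ.injOn.mono inter_subset_left) φ
  rw [MeasureTheory.setIntegral_eq_integral_of_forall_compl_eq_zero fun w hw =>
    Function.notMem_support.1 fun h => hw (hsub (hφ h))] at hcov
  rw [hcov]
  refine MeasureTheory.setIntegral_congr_fun hN'o.measurableSet fun z hz => ?_
  simp only [smul_eq_mul]
  rw [abs_of_nonneg (hpos z (interior_subset hz.2)), mul_comm]

/-- The degree integral of a map with a single, nondegenerate zero. -/
theorem exists_setIntegral_comp_mul_det_eq {F : W → W} {K Ω : Set W} (hK : IsCompact K)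
    (hΩ : IsOpen Ω) (hKΩ : K ⊆ Ω) (hF : ContDiffOn ℝ 2 F Ω)
    (hpos : ∀ z ∈ K, 0 ≤ (fderiv ℝ F z).det) {a : W} (haK : a ∈ interior K) (ha : F a = 0)
    (honly : ∀ z ∈ K, F z = 0 → z = a) (hdet : (fderiv ℝ F a).det ≠ 0) :
    ∃ ε > 0, ∀ φ : W → ℝ, Function.support φ ⊆ ball 0 ε →
      ∫ z in K, φ (F z) * (fderiv ℝ F z).det ∂μ = ∫ w, φ w ∂μ := by
  obtain ⟨N, hNK, hNo, haN, ε, hε, h⟩ := exists_nhds_setIntegral_comp_mul_det_eq (μ := μ) hΩ hF ha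
    hdet (mem_interior_iff_mem_nhds.1 haK) hKΩ hpos
  obtain ⟨δ, hδ, hδF⟩ : ∃ δ > 0, ∀ z ∈ K \ N, δ ≤ ‖F z‖ :=
    (hK.diff hNo).exists_forall_le' (hF.continuousOn.mono
      (sdiff_subset.trans hKΩ)).norm fun z hz => norm_pos_iff.2 fun h0 =>
        hz.2 (honly z hz.1 h0 ▸ haN)
  refine ⟨min ε δ, lt_min hε hδ, fun φ hφ => ?_⟩
  rw [← h φ (hφ.trans (ball_subset_ball (min_le_left _ _)))]
  refine MeasureTheory.setIntegral_eq_of_subset_of_forall_sdiff_eq_zero hK.measurableSet hNK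
    fun z hz => ?_
  have : φ (F z) = 0 := Function.notMem_support.1 fun h => by
    have := hφ h
    rw [mem_ball_zero_iff] at this
    linarith [hδF z hz, min_le_right ε δ]
  rw [this, zero_mul]

/-- Two distinct nondegenerate zeros contribute at least `2` to the degree integral. -/
theorem exists_two_mul_le_setIntegral_comp_mul_det {F : W → W} {K Ω : Set W} (hK : IsCompact K)
    (hΩ : IsOpen Ω) (hKΩ : K ⊆ Ω) (hF : ContDiffOn ℝ 2 F Ω)
    (hpos : ∀ z ∈ K, 0 ≤ (fderiv ℝ F z).det) {a b : W} (hab : a ≠ b) (haK : a ∈ interior K)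
    (hbK : b ∈ interior K) (ha : F a = 0) (hb : F b = 0) (hdeta : (fderiv ℝ F a).det ≠ 0)
    (hdetb : (fderiv ℝ F b).det ≠ 0) :
    ∃ ε > 0, ∀ φ : W → ℝ, Continuous φ → 0 ≤ φ → Function.support φ ⊆ ball 0 ε →
      2 * ∫ w, φ w ∂μ ≤ ∫ z in K, φ (F z) * (fderiv ℝ F z).det ∂μ := by
  obtain ⟨A, B, hA, hB, haA, hbB, hAB⟩ := t2_separation hab
  have hKa := mem_interior_iff_mem_nhds.1 haK
  have hKb := mem_interior_iff_mem_nhds.1 hbK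
  obtain ⟨N₁, hN₁, hN₁o, -, ε₁, hε₁, h₁⟩ := exists_nhds_setIntegral_comp_mul_det_eq (μ := μ) hΩ hF ha
    hdeta (inter_mem hKa (hA.mem_nhds haA)) (inter_subset_left.trans hKΩ)
    fun z hz => hpos z hz.1
  obtain ⟨N₂, hN₂, hN₂o, -, ε₂, hε₂, h₂⟩ := exists_nhds_setIntegral_comp_mul_det_eq (μ := μ) hΩ hF hb
    hdetb (inter_mem hKb (hB.mem_nhds hbB)) (inter_subset_left.trans hKΩ)
    fun z hz => hpos z hz.1
  refine ⟨min ε₁ ε₂, lt_min hε₁ hε₂, fun φ hφc hφ0 hφ => ?_⟩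
  have hint : MeasureTheory.IntegrableOn (fun z => φ (F z) * (fderiv ℝ F z).det) K μ := by
    refine ContinuousOn.integrableOn_compact hK (ContinuousOn.mul ?_ ?_)
    · exact hφc.comp_continuousOn (hF.continuousOn.mono hKΩ)
    · exact ContinuousLinearMap.continuous_det.comp_continuousOn
        ((hF.continuousOn_fderiv_of_isOpen hΩ (by norm_num)).mono hKΩ)
  have hN₁K : N₁ ⊆ K := hN₁.trans inter_subset_left
  have hN₂K : N₂ ⊆ K := hN₂.trans inter_subset_left
  calc 2 * ∫ w, φ w ∂μ = ∫ z in N₁ ∪ N₂, φ (F z) * (fderiv ℝ F z).det ∂μ := by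
        rw [MeasureTheory.setIntegral_union (hAB.mono (hN₁.trans inter_subset_right)
            (hN₂.trans inter_subset_right)) hN₂o.measurableSet (hint.mono_set hN₁K)
            (hint.mono_set hN₂K),
          h₁ φ (hφ.trans (ball_subset_ball (min_le_left _ _))),
          h₂ φ (hφ.trans (ball_subset_ball (min_le_right _ _))), two_mul]
    _ ≤ _ := MeasureTheory.setIntegral_mono_set hint
      ((MeasureTheory.ae_restrict_iff' hK.measurableSet).2
        (.of_forall fun z hz => mul_nonneg (hφ0 _) (hpos z hz)))
      (LE.le.eventuallyLE (union_subset hN₁K hN₂K))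

end LocalCount

/-- A degree comparison for straight-line homotopic maps with nonnegative Jacobian, the first of
which has a single nondegenerate zero. -/
theorem exists_zero_and_eq_of_homotopy {m : ℕ} {K Ω : Set (Fin m → ℝ)} (hK : IsCompact K)
    (hΩ : IsOpen Ω) (hKΩ : K ⊆ Ω) {F G : (Fin m → ℝ) → Fin m → ℝ} (hF : ContDiffOn ℝ 2 F Ω)
    (hG : ContDiffOn ℝ 2 G Ω) (hFpos : ∀ z ∈ K, 0 ≤ (fderiv ℝ F z).det)
    (hGpos : ∀ z ∈ K, 0 ≤ (fderiv ℝ G z).det)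
    (hbdry : ∀ t ∈ Icc (0 : ℝ) 1, ∀ z ∈ frontier K, F z + t • (G z - F z) ≠ 0)
    {a : Fin m → ℝ} (haK : a ∈ interior K) (ha : F a = 0)
    (honly : ∀ z ∈ K, F z = 0 → z = a) (hdet : (fderiv ℝ F a).det ≠ 0) :
    (∃ z ∈ K, G z = 0) ∧ ∀ x ∈ interior K, ∀ y ∈ interior K, G x = 0 → G y = 0 →
      (fderiv ℝ G x).det ≠ 0 → (fderiv ℝ G y).det ≠ 0 → x = y := by
  have hfr : frontier K ⊆ K := hK.isClosed.frontier_subset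
  obtain ⟨δ, hδ, hδH⟩ : ∃ δ > 0, ∀ p ∈ Icc (0 : ℝ) 1 ×ˢ frontier K,
      δ ≤ ‖F p.2 + p.1 • (G p.2 - F p.2)‖ := by
    have hKf : IsCompact (frontier K) := hK.of_isClosed_subset isClosed_frontier hfr
    have hm : MapsTo Prod.snd (Icc (0 : ℝ) 1 ×ˢ frontier K) Ω := fun p hp => hKΩ (hfr hp.2)
    have h1 := hF.continuousOn.comp continuousOn_snd hm
    have h2 := hG.continuousOn.comp continuousOn_snd hm
    exact (isCompact_Icc.prod hKf).exists_forall_le'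
      (h1.add (continuousOn_fst.smul (h2.sub h1))).norm
      fun p hp => norm_pos_iff.2 (hbdry p.1 hp.1 p.2 hp.2)
  obtain ⟨ε, hε, hεF⟩ := exists_setIntegral_comp_mul_det_eq (μ := MeasureTheory.volume) hK hΩ hKΩ
    hF hFpos haK ha honly hdet
  have key : ∀ ρ > 0, ∃ φ : (Fin m → ℝ) → ℝ, Continuous φ ∧ 0 ≤ φ ∧
      Function.support φ ⊆ ball 0 ρ ∧ 0 < ∫ w, φ w ∧
      ∫ z in K, φ (G z) * (fderiv ℝ G z).det = ∫ w, φ w := by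
    intro ρ hρ
    let r := min (min ε δ) ρ
    have hr : 0 < r := lt_min (lt_min hε hδ) hρ
    let φ : ContDiffBump (0 : Fin m → ℝ) := ⟨r / 4, r / 2, by positivity, by linarith⟩
    have hφs : Function.support φ = ball 0 (r / 2) := φ.support_eq
    have hrρ : r ≤ ρ := min_le_right _ _
    have hrε : r ≤ ε := (min_le_left _ _).trans (min_le_left _ _)
    have hrδ : r ≤ δ := (min_le_left _ _).trans (min_le_right _ _)
    refine ⟨φ, φ.continuous, fun w => φ.nonneg, ?_, φ.integral_pos, ?_⟩
    · rw [hφs]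
      exact ball_subset_ball (by linarith)
    · rw [← setIntegral_comp_mul_det_eq_of_homotopy hK hΩ hKΩ hF hG
        (φ.contDiff.differentiable (n := 1) (by simp)), hεF]
      · rw [hφs]
        exact ball_subset_ball (by linarith)
      · intro t ht z hz
        have : tsupport φ = closedBall 0 (r / 2) := φ.tsupport_eq
        rw [this, mem_closedBall_zero_iff, not_le]
        linarith [hδH (t, z) ⟨ht, hz⟩]
  refine ⟨?_, fun x hx y hy hGx hGy hdx hdy => ?_⟩
  · by_contra! hne
    obtain ⟨ρ, hρ, hρG⟩ : ∃ ρ > 0, ∀ z ∈ K, ρ ≤ ‖G z‖ :=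
      hK.exists_forall_le' (hG.continuousOn.mono hKΩ).norm fun z hz => norm_pos_iff.2 (hne z hz)
    obtain ⟨φ, -, -, hφs, hφi, hφ⟩ := key ρ hρ
    rw [MeasureTheory.setIntegral_eq_zero_of_forall_eq_zero] at hφ
    · exact hφi.ne hφ
    · intro z hz
      have : φ (G z) = 0 := Function.notMem_support.1 fun h => by
        have := hφs h
        rw [mem_ball_zero_iff] at this
        linarith [hρG z hz]
      rw [this, zero_mul]
  · by_contra hxy
    obtain ⟨ρ, hρ, hρG⟩ := exists_two_mul_le_setIntegral_comp_mul_det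
      (μ := MeasureTheory.volume) hK hΩ hKΩ hG hGpos hxy hx hy hGx hGy hdx hdy
    obtain ⟨φ, hφc, hφ0, hφs, hφi, hφ⟩ := key ρ hρ
    have := hρG φ hφc hφ0 hφs
    linarith

/-- Rouché comparison for holomorphic maps: if `F` has a single, nondegenerate zero in a ball and `G`
is close to `F` on the sphere, then `G` has a zero in the ball and at most one nondegenerate one. -/
theorem exists_zero_and_eq_of_norm_sub_lt_on_sphere {E : Type*} [NormedAddCommGroup E]
    [NormedSpace ℂ E] [FiniteDimensional ℂ E] {U : Set E} (hU : IsOpen U) {F G : E → E}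
    (hF : DifferentiableOn ℂ F U) (hG : DifferentiableOn ℂ G U) {z₀ : E} {r : ℝ} (hr : 0 < r)
    (hball : closedBall z₀ r ⊆ U) (hlt : ∀ z ∈ sphere z₀ r, ‖G z - F z‖ < ‖F z‖)
    (hz₀ : F z₀ = 0) (honly : ∀ z ∈ closedBall z₀ r, F z = 0 → z = z₀)
    (hdet : (fderiv ℂ F z₀).det ≠ 0) :
    (∃ z ∈ ball z₀ r, G z = 0) ∧ ∀ x ∈ ball z₀ r, ∀ y ∈ ball z₀ r, G x = 0 → G y = 0 →
      (fderiv ℂ G x).det ≠ 0 → (fderiv ℂ G y).det ≠ 0 → x = y := by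
  let _ : NormedSpace ℝ E := NormedSpace.complexToReal
  have : FiniteDimensional ℝ E := FiniteDimensional.complexToReal E
  have : ProperSpace E := FiniteDimensional.proper ℂ E
  let L : E ≃L[ℝ] (Fin (Module.finrank ℝ E) → ℝ) :=
    ContinuousLinearEquiv.ofFinrankEq (by simp)
  have hreal : ∀ H : E → E, DifferentiableOn ℂ H U →
      ContDiffOn ℝ 2 (fun w => L (H (L.symm w))) (L '' U) ∧
      ∀ z ∈ U, (fderiv ℝ (fun w => L (H (L.symm w))) (L z)).det =
        Complex.normSq (fderiv ℂ H z).det := by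
    intro H hH
    constructor
    · have h := (contDiffOn_of_differentiableOn_complex hU 2 hH).restrict_scalars ℝ
      refine L.contDiff.comp_contDiffOn (h.comp L.symm.contDiff.contDiffOn ?_)
      rintro _ ⟨z, hz, rfl⟩
      simpa using hz
    · intro z hz
      have hd := (hH.differentiableAt (hU.mem_nhds hz)).hasFDerivAt.restrictScalars ℝ
      have hd' : HasFDerivAt H ((fderiv ℂ H z).restrictScalars ℝ) (L.symm (L z)) := by
        simpa using hd
      have h : HasFDerivAt (fun w => L (H (L.symm w))) _ (L z) :=
        L.hasFDerivAt.comp (L z) (hd'.comp (L z) L.symm.hasFDerivAt)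
      rw [h.fderiv, ← Algebra.norm_complex_apply]
      have h1 := LinearMap.det_conj
        ((fderiv ℂ H z).toLinearMap.restrictScalars ℝ) L.toLinearEquiv
      have h2 := LinearMap.det_restrictScalars (R := ℝ) (S := ℂ)
        (f := (fderiv ℂ H z).toLinearMap)
      rw [h2] at h1
      exact h1
  have hfr : frontier (L '' closedBall z₀ r) = L '' sphere z₀ r := by
    rw [← frontier_closedBall z₀ hr.ne']
    exact (L.toHomeomorph.image_frontier _).symm
  have hint : interior (L '' closedBall z₀ r) = L '' ball z₀ r := by
    rw [← interior_closedBall z₀ hr.ne']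
    exact (L.toHomeomorph.image_interior _).symm
  obtain ⟨hF2, hFd⟩ := hreal F hF
  obtain ⟨hG2, hGd⟩ := hreal G hG
  have hz₀K : z₀ ∈ closedBall z₀ r := mem_closedBall_self hr.le
  have hL0 : ∀ z, L z = 0 ↔ z = 0 := fun z => L.map_eq_zero_iff
  obtain ⟨hex, huniq⟩ := exists_zero_and_eq_of_homotopy
    ((isCompact_closedBall z₀ r).image L.continuous) (L.toHomeomorph.isOpenMap _ hU)
    (image_mono hball) hF2 hG2
    (by rintro _ ⟨z, hz, rfl⟩; rw [hFd z (hball hz)]; exact Complex.normSq_nonneg _)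
    (by rintro _ ⟨z, hz, rfl⟩; rw [hGd z (hball hz)]; exact Complex.normSq_nonneg _)
    (by
      rw [hfr]
      rintro t ht _ ⟨z, hz, rfl⟩
      simp only [ContinuousLinearEquiv.symm_apply_apply]
      rw [← map_sub, ← map_smul, ← map_add, Ne, hL0]
      intro h
      have h1 : ‖F z‖ = t * ‖G z - F z‖ := by
        rw [← Real.norm_of_nonneg ht.1, ← norm_smul, ← norm_neg (t • _),
          ← eq_neg_of_add_eq_zero_left h]
      have h2 := hlt z hz
      nlinarith [ht.2, norm_nonneg (G z - F z)])
    (a := L z₀)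
    (by rw [hint]; exact mem_image_of_mem _ (mem_ball_self hr))
    (by simp [hz₀])
    (by
      rintro _ ⟨z, hz, rfl⟩ h
      simp only [ContinuousLinearEquiv.symm_apply_apply, hL0] at h
      rw [honly z hz h])
    (by rw [hFd z₀ (hball hz₀K)]; simpa using hdet)
  constructor
  · obtain ⟨_, ⟨z, hz, rfl⟩, h⟩ := hex
    simp only [ContinuousLinearEquiv.symm_apply_apply, hL0] at h
    refine ⟨z, ?_, h⟩
    rw [← ball_union_sphere] at hz
    refine hz.resolve_right fun hs => ?_
    have := hlt z hs
    simp [h] at this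
  · intro x hx y hy hGx hGy hdx hdy
    rw [hint] at huniq
    refine L.injective (huniq _ (mem_image_of_mem _ hx) _ (mem_image_of_mem _ hy) ?_ ?_ ?_ ?_)
    · simp [hGx]
    · simp [hGy]
    · rw [hGd x (hball (ball_subset_closedBall hx))]; simpa using hdx
    · rw [hGd y (hball (ball_subset_closedBall hy))]; simpa using hdy

theorem eventually_det_add_smul_id_ne_zero {E : Type*} [NormedAddCommGroup E]
    [NormedSpace ℂ E] [FiniteDimensional ℂ E] (A : E →L[ℂ] E) :
    ∀ᶠ ε : ℝ in 𝓝[>] 0, (A + (ε : ℂ) • .id ℂ E).det ≠ 0 := by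
  have hfin := (Module.End.finite_hasEigenvalue (A : Module.End ℂ E)).preimage
    (f := fun ε : ℝ => -(ε : ℂ)) (fun x _ y _ h => by simpa using h)
  have hmem := (hfin.sdiff (t := {0})).isClosed.isOpen_compl.mem_nhds (x := 0) (by simp)
  filter_upwards [mem_nhdsWithin_of_mem_nhds hmem, self_mem_nhdsWithin] with ε hε hpos hdet
  refine hε ⟨?_, (mem_Ioi.1 hpos).ne'⟩
  obtain ⟨v, hv, hv0⟩ := Submodule.exists_mem_ne_zero_of_ne_bot
    (LinearMap.det_eq_zero_iff_ker_ne_bot.1 hdet)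
  have hv' : A v + (ε : ℂ) • v = 0 := hv
  refine Module.End.hasEigenvalue_of_hasEigenvector (x := v)
    (Module.End.hasEigenvector_iff.2 ⟨Module.End.mem_eigenspace_iff.2 ?_, hv0⟩)
  rw [neg_smul]
  exact eq_neg_of_add_eq_zero_left hv'

/-- Rouché uniqueness: if `F` has a single, nondegenerate zero in a ball and `G` is close to `F` on
the sphere, then `G` has at most one zero in the ball. Two zeros are made nondegenerate by a small
perturbation of `G`. -/
theorem eq_of_norm_sub_lt_on_sphere {E : Type*} [NormedAddCommGroup E]
    [NormedSpace ℂ E] [FiniteDimensional ℂ E] {U : Set E} (hU : IsOpen U) {F G : E → E}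
    (hF : DifferentiableOn ℂ F U) (hG : DifferentiableOn ℂ G U) {z₀ : E} {r : ℝ} (hr : 0 < r)
    (hball : closedBall z₀ r ⊆ U) (hlt : ∀ z ∈ sphere z₀ r, ‖G z - F z‖ < ‖F z‖)
    (hz₀ : F z₀ = 0) (honly : ∀ z ∈ closedBall z₀ r, F z = 0 → z = z₀)
    (hdet : (fderiv ℂ F z₀).det ≠ 0) {a b : E} (ha : a ∈ ball z₀ r) (hb : b ∈ ball z₀ r)
    (hGa : G a = 0) (hGb : G b = 0) : a = b := by
  by_contra hab
  have : ProperSpace E := FiniteDimensional.proper ℂ E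
  obtain ⟨ℓ, hℓ⟩ : ∃ ℓ : E →L[ℂ] ℂ, ℓ (b - a) = 1 :=
    SeparatingDual.exists_eq_one (sub_ne_zero.2 (Ne.symm hab))
  let P : E → E := fun z => (1 - ℓ (z - a)) ^ 2 • (z - a) + ℓ (z - a) ^ 2 • (z - b)
  have hPd : Differentiable ℂ P := by fun_prop
  have hPa : P a = 0 := by simp [P]
  have hPb : P b = 0 := by simp [P, hℓ, -map_sub]
  have hs : ∀ z, HasFDerivAt (fun z => ℓ (z - a)) ℓ z := fun z =>
    ℓ.hasFDerivAt.comp z ((hasFDerivAt_id z).sub_const a)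
  have hP' : ∀ z, HasFDerivAt P _ z := fun z =>
    ((((hasFDerivAt_const (1 : ℂ) z).sub (hs z)).pow 2).smul ((hasFDerivAt_id z).sub_const a)).add
      (((hs z).pow 2).smul ((hasFDerivAt_id z).sub_const b))
  have hPa' : HasFDerivAt P (.id ℂ E) a := by
    refine (hP' a).congr_fderiv ?_
    ext v
    simp
  have hPb' : HasFDerivAt P (.id ℂ E) b := by
    refine (hP' b).congr_fderiv ?_
    ext v
    simp [hℓ, -map_sub]
  have hGd : ∀ z ∈ ball z₀ r, HasFDerivAt G (fderiv ℂ G z) z := fun z hz =>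
    (hG.differentiableAt (hU.mem_nhds (hball (ball_subset_closedBall hz)))).hasFDerivAt
  have hcomp : IsCompact (sphere z₀ r) := isCompact_sphere z₀ r
  have hsU : sphere z₀ r ⊆ U := sphere_subset_closedBall.trans hball
  have hFs := hF.continuousOn.mono hsU
  have hGs := hG.continuousOn.mono hsU
  obtain ⟨δ, hδ, hδle⟩ := hcomp.exists_forall_le' (f := fun z => ‖F z‖ - ‖G z - F z‖)
    (hFs.norm.sub (hGs.sub hFs).norm) (a := 0) fun z hz => sub_pos.2 (hlt z hz)
  obtain ⟨C, hC⟩ := hcomp.exists_bound_of_continuousOn hPd.continuous.continuousOn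
  have hne := eventually_det_add_smul_id_ne_zero (E := E)
  have hsmall : ∀ᶠ ε : ℝ in 𝓝[>] 0, ε * C < δ := by
    have : Tendsto (fun ε : ℝ => ε * C) (𝓝[>] 0) (𝓝 (0 * C)) :=
      (tendsto_id.mono_left nhdsWithin_le_nhds).mul_const C
    rw [zero_mul] at this
    exact this.eventually_lt_const hδ
  obtain ⟨ε, hεa, hεb, hεC, hε⟩ := ((hne (fderiv ℂ G a)).and ((hne (fderiv ℂ G b)).and
    (hsmall.and self_mem_nhdsWithin))).exists
  refine hab ((exists_zero_and_eq_of_norm_sub_lt_on_sphere hU hF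
    (G := fun z => G z + (ε : ℂ) • P z) (hG.add (hPd.differentiableOn.const_smul _)) hr hball
    (fun z hz => ?_) hz₀ honly hdet).2 a ha b hb ?_ ?_ ?_ ?_)
  · have h1 : ‖G z + (ε : ℂ) • P z - F z‖ ≤ ‖G z - F z‖ + ε * ‖P z‖ := by
      rw [add_sub_right_comm]
      refine (norm_add_le _ _).trans_eq ?_
      rw [norm_smul, Complex.norm_real, Real.norm_of_nonneg (le_of_lt hε)]
    have h2 := hδle z hz
    have h3 := mul_le_mul_of_nonneg_left (hC z hz) (le_of_lt hε)
    linarith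
  · simp [hGa, hPa]
  · simp [hGb, hPb]
  · rwa [HasFDerivAt.fderiv (f := fun z => G z + (ε : ℂ) • P z)
      ((hGd a ha).add (hPa'.const_smul (ε : ℂ)))]
  · rwa [HasFDerivAt.fderiv (f := fun z => G z + (ε : ℂ) • P z)
      ((hGd b hb).add (hPb'.const_smul (ε : ℂ)))]

/-- Rouché-type uniqueness of fixed points: if `z₀` is the unique fixed point of the
holomorphic map `f` in the closed ball of radius `r`, `1` is not an eigenvalue of
`df(z₀)`, and `g` is holomorphic with `‖g - f‖ < ‖f - id‖` on the boundary sphere,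
then `g` has exactly one fixed point in the open ball `B(z₀, r)`. -/
theorem rouche_unique_fixed_point {n : ℕ} (U : Set (CSpace n)) (hU : IsOpen U)
    (f : CSpace n → CSpace n) (hf : DifferentiableOn ℂ f U)
    (z₀ : CSpace n) (r : ℝ) (hr : 0 < r)
    (hball : Metric.closedBall z₀ r ⊆ U)
    (hfix : f z₀ = z₀)
    (honly : ∀ z ∈ Metric.closedBall z₀ r, z ≠ z₀ → f z ≠ z)
    (heig : ¬ ∃ v : CSpace n, v ≠ 0 ∧ fderiv ℂ f z₀ v = v)
    (g : CSpace n → CSpace n) (hg : DifferentiableOn ℂ g U)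
    (hclose : ∀ z ∈ Metric.sphere z₀ r, ‖g z - f z‖ < ‖f z - z‖) :
    ∃! z, z ∈ Metric.ball z₀ r ∧ g z = z := by
  have hmem : z₀ ∈ U := hball (mem_closedBall_self hr.le)
  have hdF : DifferentiableOn ℂ (fun z => z - f z) U := differentiableOn_id.sub hf
  have hdG : DifferentiableOn ℂ (fun z => z - g z) U := differentiableOn_id.sub hg
  have hlt : ∀ z ∈ sphere z₀ r, ‖(z - g z) - (z - f z)‖ < ‖z - f z‖ := fun z hz => by
    rw [sub_sub_sub_cancel_left, norm_sub_rev, norm_sub_rev z]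
    exact hclose z hz
  have hF0 : z₀ - f z₀ = 0 := by rw [hfix, sub_self]
  have honlyF : ∀ z ∈ closedBall z₀ r, z - f z = 0 → z = z₀ := fun z hz h =>
    by_contra fun hne => honly z hz hne (sub_eq_zero.1 h).symm
  have hdet : (fderiv ℂ (fun z => z - f z) z₀).det ≠ 0 := by
    intro h0
    have hderiv : HasFDerivAt (fun z => z - f z) _ z₀ :=
      (hasFDerivAt_id z₀).sub (hf.differentiableAt (hU.mem_nhds hmem)).hasFDerivAt
    rw [hderiv.fderiv] at h0
    obtain ⟨v, hv, hv0⟩ := Submodule.exists_mem_ne_zero_of_ne_bot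
      (LinearMap.det_eq_zero_iff_ker_ne_bot.1 h0)
    exact heig ⟨v, hv0, (sub_eq_zero.1 hv).symm⟩
  obtain ⟨a, ha, hGa⟩ := (exists_zero_and_eq_of_norm_sub_lt_on_sphere hU hdF hdG hr hball hlt hF0
    honlyF hdet).1
  refine ⟨a, ⟨ha, (sub_eq_zero.1 hGa).symm⟩, fun b ⟨hb, hgb⟩ => ?_⟩
  exact eq_of_norm_sub_lt_on_sphere hU hdF hdG hr hball hlt hF0 honlyF hdet hb ha
    (sub_eq_zero.2 hgb.symm) hGa
end
end

section
/- Let D ⊆ ℂ be a domain (nonempty connected open subset of the complex plane) and let f be an automorphism of D that is not the identity map. Then f has at most two fixed points: the cardinality of {z ∈ D : f(z) = z} is at most 2. -/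
open Set

/-- `f` is an automorphism of the planar domain `D`: a holomorphic bijection of `D`
onto itself with holomorphic inverse. -/
def PlanarAutOn (D : Set ℂ) (f : ℂ → ℂ) : Prop :=
  DifferentiableOn ℂ f D ∧ Set.BijOn f D D ∧
  ∃ g : ℂ → ℂ, DifferentiableOn ℂ g D ∧ Set.BijOn g D D ∧
    (∀ z ∈ D, g (f z) = z) ∧ (∀ z ∈ D, f (g z) = z)

section

open Metric Filter Topology

/-- A Bloch-type theorem, with a non-optimal constant. -/
theorem exists_ball_subset_image_ball {ψ : ℂ → ℂ} {p : ℂ} {R : ℝ} (hR : 0 < R)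
    (hψ : DifferentiableOn ℂ ψ (ball p R)) :
    ∃ w, ball w (R * ‖deriv ψ p‖ / 96) ⊆ ψ '' ball p R := by
  have hd : DifferentiableOn ℂ (deriv ψ) (ball p R) := hψ.deriv isOpen_ball
  have hsub : closedBall p (R / 2) ⊆ ball p R := closedBall_subset_ball (by linarith)
  obtain ⟨z₀, hz₀, hmax⟩ := (isCompact_closedBall p (R / 2)).exists_isMaxOn
    (f := fun z ↦ ‖deriv ψ z‖ * (R / 2 - dist z p)) ⟨p, by simp; positivity⟩
    ((hd.mono hsub).continuousOn.norm.mul (by fun_prop))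
  rw [isMaxOn_iff] at hmax
  have hp := hmax p (by simp; positivity)
  simp only [dist_self, sub_zero] at hp
  rcases eq_or_ne (deriv ψ p) 0 with h0 | h0
  · exact ⟨0, by simp [h0]⟩
  have hp0 : 0 < ‖deriv ψ p‖ := norm_pos_iff.2 h0
  set m := ‖deriv ψ z₀‖ with hm
  set ρ := (R / 2 - dist z₀ p) / 2 with hρ
  have hmρ : ‖deriv ψ p‖ * R / 4 ≤ m * ρ := by rw [hρ]; linarith
  have hz₀' : dist z₀ p ≤ R / 2 := by simpa using hz₀
  have hρ0 : 0 < ρ := by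
    have : 0 < m * ρ := lt_of_lt_of_le (by positivity) hmρ
    exact pos_of_mul_pos_right this (norm_nonneg _)
  have hm0 : 0 < m := by
    have : 0 < m * ρ := lt_of_lt_of_le (by positivity) hmρ
    exact pos_of_mul_pos_left this hρ0.le
  have hin : ∀ z ∈ ball z₀ ρ, dist z p < R / 2 - ρ := fun z hz ↦ by
    have := dist_triangle z z₀ p
    rw [mem_ball] at hz
    linarith
  have hballsub : ball z₀ ρ ⊆ ball p R := fun z hz ↦ by
    have := hin z hz
    rw [mem_ball]; linarith
  have hle : ∀ z ∈ ball z₀ ρ, ‖deriv ψ z‖ ≤ 2 * m := fun z hz ↦ by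
    have h1 := hin z hz
    have h2 := hmax z (by rw [mem_closedBall]; linarith)
    have h3 : ‖deriv ψ z‖ * ρ ≤ ‖deriv ψ z‖ * (R / 2 - dist z p) := by gcongr; linarith
    have h4 : ‖deriv ψ z‖ * ρ ≤ (2 * m) * ρ := by
      calc _ ≤ _ := h3
        _ ≤ _ := h2
        _ = _ := by rw [hρ]; ring
    exact le_of_mul_le_mul_right h4 hρ0
  have hschwarz : ∀ z ∈ ball z₀ ρ, ‖deriv ψ z - deriv ψ z₀‖ ≤ 3 * m / ρ * dist z z₀ := by
    intro z hz
    rw [← dist_eq_norm]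
    refine Complex.dist_le_div_mul_dist_of_mapsTo_ball (hd.mono hballsub) (fun w hw ↦ ?_) hz
    rw [mem_closedBall, dist_eq_norm]
    calc _ ≤ _ := norm_sub_le _ _
      _ ≤ 3 * m := by linarith [hle w hw]
  set r := ρ / 6 with hr
  have hr0 : 0 < r := by positivity
  have hrs : closedBall z₀ r ⊆ ball z₀ ρ := closedBall_subset_ball (by rw [hr]; linarith)
  have hψat : ∀ z ∈ ball z₀ ρ, DifferentiableAt ℂ ψ z := fun z hz ↦
    hψ.differentiableAt (isOpen_ball.mem_nhds (hballsub hz))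
  have hsphere : ∀ z ∈ sphere z₀ r, m * r / 2 ≤ ‖ψ z - ψ z₀‖ := by
    intro z hz
    have hzd : dist z z₀ = r := hz
    have key := (convex_closedBall z₀ r).norm_image_sub_le_of_norm_deriv_le
      (f := fun z ↦ ψ z - deriv ψ z₀ * z) (C := m / 2) (x := z₀) (y := z)
      (fun w hw ↦ (hψat w (hrs hw)).sub (by fun_prop)) (fun w hw ↦ by
        rw [deriv_fun_sub (hψat w (hrs hw)) (by fun_prop), deriv_const_mul_id']
        refine (hschwarz w (hrs hw)).trans ?_
        calc _ ≤ 3 * m / ρ * r := by gcongr; exact hw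
          _ = m / 2 := by rw [hr]; field_simp; norm_num)
      (mem_closedBall_self hr0.le) (sphere_subset_closedBall hz)
    rw [← dist_eq_norm z z₀, hzd] at key
    have h2 : ‖deriv ψ z₀ * (z - z₀)‖ = m * r := by rw [norm_mul, ← dist_eq_norm z z₀, hzd]
    have h3 := norm_sub_norm_le (deriv ψ z₀ * (z - z₀)) (ψ z - ψ z₀)
    have h4 : ‖deriv ψ z₀ * (z - z₀) - (ψ z - ψ z₀)‖ ≤ m / 2 * r := by
      rw [norm_sub_rev]
      exact (congrArg norm (by ring)).trans_le key
    linarith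
  refine ⟨ψ z₀, ?_⟩
  have hfreq : ∃ᶠ z in 𝓝 z₀, ψ z ≠ ψ z₀ := by
    intro hev
    have : deriv ψ z₀ = 0 := by
      have h : ψ =ᶠ[𝓝 z₀] fun _ ↦ ψ z₀ := by filter_upwards [hev] with z hz using not_not.1 hz
      rw [h.deriv_eq]; simp
    rw [hm, this] at hm0
    simp at hm0
  have := DiffContOnCl.ball_subset_image_closedBall (f := ψ) (r := r) (z₀ := z₀)
    (DifferentiableOn.diffContOnCl_ball (U := ball z₀ ρ) (hψ.mono hballsub) hrs)
    hr0 hsphere hfreq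
  refine (ball_subset_ball ?_).trans (this.trans (image_mono (hrs.trans hballsub)))
  rw [hr]; linarith

/-- A continuous logarithm of a holomorphic function is holomorphic. -/
theorem differentiableOn_of_exp_comp_eq {U : Set ℂ} (hU : IsOpen U) {L q : ℂ → ℂ}
    (hL : ContinuousOn L U) (hq : DifferentiableOn ℂ q U) (h : ∀ z ∈ U, Complex.exp (L z) = q z) :
    DifferentiableOn ℂ L U := by
  intro p hp
  have hqp : q p ≠ 0 := h p hp ▸ Complex.exp_ne_zero _
  have hqd : DifferentiableAt ℂ q p := hq.differentiableAt (hU.mem_nhds hp)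
  have hLc : ContinuousAt L p := hL.continuousAt (hU.mem_nhds hp)
  have hev : L =ᶠ[𝓝 p] fun z ↦ L p + Complex.log (q z / q p) := by
    filter_upwards [hU.mem_nhds hp, hLc.eventually (ball_mem_nhds _ Real.pi_pos)] with z hz hzb
    have him : |(L z - L p).im| < Real.pi :=
      (Complex.abs_im_le_norm _).trans_lt (by rwa [← dist_eq_norm])
    rw [abs_lt] at him
    rw [← h z hz, ← h p hp, ← Complex.exp_sub, Complex.log_exp him.1 him.2.le]
    ring
  refine (DifferentiableAt.congr_of_eventuallyEq ?_ hev).differentiableWithinAt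
  refine (DifferentiableAt.clog (hqd.div_const _) ?_).const_add _
  rw [div_self hqp]
  exact Complex.one_mem_slitPlane

/-- The logarithmic derivative of a nonvanishing univalent function on a disc is bounded in terms
of the radius: a logarithm of such a function omits a pair of points differing by `2πi`, so its
image contains no large disc. -/
theorem norm_logDeriv_mul_le_of_injOn {h : ℂ → ℂ} {p : ℂ} {R : ℝ} (hR : 0 < R)
    (hd : DifferentiableOn ℂ h (ball p R)) (hinj : InjOn h (ball p R))
    (h0 : ∀ z ∈ ball p R, h z ≠ 0) :
    ‖logDeriv h p‖ * R ≤ 384 := by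
  have := contractibleSpace_ball (x := p) hR
  have hsc : IsSimplyConnected (ball p R) := SimplyConnectedSpace.ofContractible _
  obtain ⟨ψ, hψc, hψ⟩ := Complex.exists_continuousOn_eqOn_exp_comp hsc isOpen_ball
    hd.continuousOn (by rintro ⟨z, hz, hz0⟩; exact h0 z hz hz0)
  have hψd := differentiableOn_of_exp_comp_eq isOpen_ball hψc hd hψ
  have hpn : ball p R ∈ 𝓝 p := ball_mem_nhds p hR
  have hlog : logDeriv h p = deriv ψ p := by
    have : h =ᶠ[𝓝 p] fun z ↦ Complex.exp (ψ z) := by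
      filter_upwards [hpn] with z hz using (hψ hz).symm
    rw [logDeriv_apply, this.deriv_eq, this.self_of_nhds,
      (hψd.differentiableAt hpn).hasDerivAt.cexp.deriv]
    field_simp [Complex.exp_ne_zero]
  obtain ⟨w, hw⟩ := exists_ball_subset_image_ball hR hψd
  rw [hlog]
  by_contra! hcon
  have hmem : ∀ x : ℂ, ‖x‖ ≤ Real.pi → w + x ∈ ψ '' ball p R := fun x hx ↦ hw <| by
    rw [mem_ball, dist_eq_norm, add_sub_cancel_left]
    linarith [Real.pi_lt_four]
  obtain ⟨x, hx, hxw⟩ := hmem (Real.pi * Complex.I) (by simp [abs_of_pos Real.pi_pos])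
  obtain ⟨y, hy, hyw⟩ := hmem (-(Real.pi * Complex.I)) (by simp [abs_of_pos Real.pi_pos])
  have hxy : x = y := hinj hx hy <| by
    rw [← hψ hx, ← hψ hy]
    simp only [Function.comp_apply, hxw, hyw, Complex.exp_add, Complex.exp_neg, Complex.exp_pi_mul_I]
    norm_num
  have : (Real.pi : ℂ) * Complex.I = -(Real.pi * Complex.I) := by
    rw [hxy, hyw] at hxw
    exact (add_left_cancel hxw).symm
  rw [self_eq_neg] at this
  simp [Real.pi_ne_zero] at this

/-- The difference quotient of a holomorphic function is jointly continuous. -/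
theorem continuousOn_dslope_uncurry {f : ℂ → ℂ} {D : Set ℂ} (hD : IsOpen D)
    (hf : DifferentiableOn ℂ f D) :
    ContinuousOn (fun x : ℂ × ℂ ↦ dslope f x.1 x.2) (D ×ˢ D) := by
  rintro ⟨a, b⟩ ⟨ha, hb⟩
  apply ContinuousAt.continuousWithinAt
  have hfc : ∀ z ∈ D, ContinuousAt f z := fun z hz ↦ hf.continuousOn.continuousAt (hD.mem_nhds hz)
  rcases ne_or_eq a b with hab | rfl
  · have hev : (fun x : ℂ × ℂ ↦ dslope f x.1 x.2) =ᶠ[𝓝 (a, b)]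
        fun x ↦ (x.2 - x.1)⁻¹ * (f x.2 - f x.1) := by
      have hne : ∀ᶠ x : ℂ × ℂ in 𝓝 (a, b), x.1 ≠ x.2 :=
        (isOpen_ne_fun continuous_fst continuous_snd).mem_nhds hab
      filter_upwards [hne] with x hx
      rw [dslope_of_ne f hx.symm, slope, vsub_eq_sub, smul_eq_mul]
    refine ContinuousAt.congr ?_ hev.symm
    have h1 : ContinuousAt (fun x : ℂ × ℂ ↦ f x.1) (a, b) :=
      ContinuousAt.comp (f := Prod.fst) (hfc a ha) continuousAt_fst
    have h2 : ContinuousAt (fun x : ℂ × ℂ ↦ f x.2) (a, b) :=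
      ContinuousAt.comp (f := Prod.snd) (hfc b hb) continuousAt_snd
    exact ((continuousAt_snd.sub continuousAt_fst).inv₀ (sub_ne_zero.2 hab.symm)).mul (h2.sub h1)
  · have hstrict : HasStrictDerivAt f (deriv f a) a :=
      ((hf.analyticAt (hD.mem_nhds ha))).hasStrictDerivAt
    have hderiv : ContinuousAt (deriv f) a :=
      (hf.deriv hD).continuousOn.continuousAt (hD.mem_nhds ha)
    rw [Metric.continuousAt_iff']
    intro ε hε
    have h1 := hstrict.hasStrictFDerivAt.isLittleO.def (half_pos hε)
    have hderiv' : ContinuousAt (fun x : ℂ × ℂ ↦ deriv f x.1) (a, a) :=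
      ContinuousAt.comp (g := deriv f) (f := Prod.fst) (x := (a, a)) hderiv continuousAt_fst
    have h2 := hderiv'.eventually (ball_mem_nhds _ hε)
    filter_upwards [h1, h2] with ⟨x, y⟩ h1 h2
    rcases eq_or_ne y x with rfl | hyx
    · simpa [dslope_same] using h2
    · have hxy : 0 < ‖x - y‖ := norm_pos_iff.2 (sub_ne_zero.2 hyx.symm)
      simp only [dslope_same, dslope_of_ne f hyx, slope, vsub_eq_sub, smul_eq_mul, dist_eq_norm]
      simp only [ContinuousLinearMap.toSpanSingleton_apply, smul_eq_mul] at h1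
      have h3 : (y - x)⁻¹ * (f y - f x) - deriv f a =
          (x - y)⁻¹ * (f x - f y - (x - y) * deriv f a) := by
        have := sub_ne_zero.2 hyx
        have := sub_ne_zero.2 hyx.symm
        field_simp
        ring
      rw [h3, norm_mul, norm_inv, inv_mul_lt_iff₀ hxy]
      nlinarith

theorem dslope_ne_zero_of_injOn {f : ℂ → ℂ} {D : Set ℂ} (hinj : InjOn f D)
    (hf' : ∀ z ∈ D, deriv f z ≠ 0) {a z : ℂ} (ha : a ∈ D) (hz : z ∈ D) : dslope f a z ≠ 0 := by
  rcases eq_or_ne z a with rfl | h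
  · simpa [dslope_same] using hf' z hz
  · rw [dslope_of_ne f h, slope, vsub_eq_sub, smul_eq_mul]
    exact mul_ne_zero (inv_ne_zero (sub_ne_zero.2 h)) (sub_ne_zero.2 fun e ↦ h (hinj hz ha e))

/-- For a locally biholomorphic injective `f` on a domain, the quotient of two difference quotients
of `f` has a holomorphic logarithm, obtained by lifting the homotopy that moves `b` to `a`. -/
theorem exists_exp_eq_dslope_div_dslope {f : ℂ → ℂ} {D : Set ℂ} (hD : IsOpen D)
    (hDc : IsConnected D) (hf : DifferentiableOn ℂ f D) (hinj : InjOn f D)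
    (hf' : ∀ z ∈ D, deriv f z ≠ 0) {a b : ℂ} (ha : a ∈ D) (hb : b ∈ D) :
    ∃ L : ℂ → ℂ, DifferentiableOn ℂ L D ∧
      ∀ z ∈ D, Complex.exp (L z) = dslope f a z / dslope f b z := by
  classical
  have hne {x z : ℂ} (hx : x ∈ D) (hz : z ∈ D) := dslope_ne_zero_of_injOn hinj hf' hx hz
  obtain ⟨σ, hσ⟩ := ((hD.isConnected_iff_isPathConnected.1 hDc).joinedIn b hb a ha)
  have hcont (τ : unitInterval × D → ℂ) (hτ : Continuous τ) (hτD : ∀ x, τ x ∈ D) :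
      Continuous fun x : unitInterval × D ↦ dslope f (τ x) x.2 :=
    (continuousOn_dslope_uncurry hD hf).comp_continuous
      (hτ.prodMk (continuous_subtype_val.comp continuous_snd)) fun x ↦ ⟨hτD x, x.2.2⟩
  let H : C(unitInterval × D, {z : ℂ // z ≠ 0}) :=
    ⟨fun x ↦ ⟨dslope f (σ x.1) x.2 / dslope f b x.2,
      div_ne_zero (hne (hσ _) x.2.2) (hne hb x.2.2)⟩,
      ((hcont _ (σ.continuous.comp continuous_fst) fun x ↦ hσ _).div
        (hcont _ continuous_const fun _ ↦ hb) fun x ↦ hne hb x.2.2).subtype_mk _⟩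
  have H0 : ∀ z : D, H (0, z) = ⟨_, Complex.exp_ne_zero ((ContinuousMap.const D (0 : ℂ)) z)⟩ :=
    fun z ↦ Subtype.ext (by simp [H, div_self (hne hb z.2)])
  let K := Complex.isCoveringMap_exp.liftHomotopy H (.const D 0) H0
  have hK : ∀ z : D, Complex.exp (K (1, z)) = dslope f a z / dslope f b z := fun z ↦ by
    have := congrArg Subtype.val
      (congrFun (Complex.isCoveringMap_exp.liftHomotopy_lifts H (.const D 0) H0) (1, z))
    exact this.trans (by simp [H])
  let L : ℂ → ℂ := fun z ↦ if hz : z ∈ D then K (1, ⟨z, hz⟩) else 0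
  have hL : ∀ z : D, L z = K (1, z) := fun z ↦ by simp [L]
  have hexp : ∀ z ∈ D, Complex.exp (L z) = dslope f a z / dslope f b z := fun z hz ↦ by
    rw [hL ⟨z, hz⟩, hK]
  refine ⟨L, differentiableOn_of_exp_comp_eq hD ?_ (DifferentiableOn.fun_div
    ((Complex.differentiableOn_dslope (hD.mem_nhds ha)).2 hf)
    ((Complex.differentiableOn_dslope (hD.mem_nhds hb)).2 hf) fun z hz ↦ hne hb hz) hexp, hexp⟩
  rw [continuousOn_iff_continuous_domRestrict]
  have : D.domRestrict L = fun z ↦ K (1, z) := funext hL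
  rw [this]
  fun_prop

theorem differentiableOn_iterate {f : ℂ → ℂ} {D : Set ℂ} (hf : DifferentiableOn ℂ f D)
    (hm : MapsTo f D D) (n : ℕ) : DifferentiableOn ℂ f^[n] D := by
  induction n with
  | zero => exact differentiableOn_id
  | succ n ih => rw [Function.iterate_succ']; exact hf.comp ih (hm.iterate n)

theorem iterate_ne_of_injOn {α : Type*} {f : α → α} {D : Set α} (hinj : InjOn f D)
    (hm : MapsTo f D D) {a z : α} (ha : a ∈ D) (hz : z ∈ D) (hfa : f a = a) (h : z ≠ a) (n : ℕ) :
    f^[n] z ≠ a := fun e ↦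
  h (hinj.iterate hm n hz ha (e.trans (Function.iterate_fixed hfa n).symm))

/-- The Birkhoff sums of `L` are logarithms of `(u ∘ f^[n]) / u`, where `u z = (z - a) / (z - b)`. -/
theorem exp_birkhoffSum_eq {f L : ℂ → ℂ} {D : Set ℂ} (hinj : InjOn f D) (hm : MapsTo f D D)
    {a b : ℂ} (ha : a ∈ D) (hb : b ∈ D) (hfa : f a = a) (hfb : f b = b)
    (hL : ∀ z ∈ D, Complex.exp (L z) = dslope f a z / dslope f b z)
    {z : ℂ} (hz : z ∈ D) (hza : z ≠ a) (hzb : z ≠ b) (n : ℕ) :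
    Complex.exp (birkhoffSum f L n z) =
      ((f^[n] z - a) / (f^[n] z - b)) / ((z - a) / (z - b)) := by
  have hA := sub_ne_zero.2 hza
  have hB := sub_ne_zero.2 hzb
  induction n with
  | zero => simp [div_self (div_ne_zero hA hB)]
  | succ n ih =>
    have hwa := iterate_ne_of_injOn hinj hm ha hz hfa hza n
    have hwb := iterate_ne_of_injOn hinj hm hb hz hfb hzb n
    have hwb' := iterate_ne_of_injOn hinj hm hb hz hfb hzb (n + 1)
    rw [Function.iterate_succ_apply'] at hwb'
    rw [birkhoffSum_succ, Complex.exp_add, ih, hL _ (hm.iterate n hz), dslope_of_ne f hwa,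
      dslope_of_ne f hwb, Function.iterate_succ_apply']
    simp only [slope, vsub_eq_sub, smul_eq_mul, hfa, hfb]
    have := sub_ne_zero.2 hwa
    have := sub_ne_zero.2 hwb
    have := sub_ne_zero.2 hwb'
    field_simp

theorem differentiableOn_birkhoffSum {f L : ℂ → ℂ} {D : Set ℂ} (hf : DifferentiableOn ℂ f D)
    (hm : MapsTo f D D) (hL : DifferentiableOn ℂ L D) (n : ℕ) :
    DifferentiableOn ℂ (birkhoffSum f L n) D :=
  DifferentiableOn.fun_sum fun k _ ↦ hL.comp (differentiableOn_iterate hf hm k) (hm.iterate k)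

theorem norm_deriv_birkhoffSum_mul_le {f L : ℂ → ℂ} {D : Set ℂ}
    (hf : DifferentiableOn ℂ f D) (hinj : InjOn f D) (hm : MapsTo f D D)
    {a b : ℂ} (ha : a ∈ D) (hb : b ∈ D) (hab : a ≠ b) (hfa : f a = a) (hfb : f b = b)
    (hLd : DifferentiableOn ℂ L D)
    (hL : ∀ z ∈ D, Complex.exp (L z) = dslope f a z / dslope f b z)
    {z : ℂ} {r : ℝ} (hr : 0 < r) (hball : ball z r ⊆ D \ {a, b}) (n : ℕ) :
    ‖deriv (birkhoffSum f L n) z‖ * r ≤ 768 := by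
  let h : ℕ → ℂ → ℂ := fun k w ↦ (f^[k] w - a) / (f^[k] w - b)
  have hBD : ball z r ⊆ D := hball.trans sdiff_subset
  have hne : ∀ w ∈ ball z r, w ≠ a ∧ w ≠ b := fun w hw ↦ by simpa using (hball hw).2
  have hka : ∀ k, ∀ w ∈ ball z r, f^[k] w - a ≠ 0 := fun k w hw ↦
    sub_ne_zero.2 (iterate_ne_of_injOn hinj hm ha (hBD hw) hfa (hne w hw).1 k)
  have hkb : ∀ k, ∀ w ∈ ball z r, f^[k] w - b ≠ 0 := fun k w hw ↦
    sub_ne_zero.2 (iterate_ne_of_injOn hinj hm hb (hBD hw) hfb (hne w hw).2 k)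
  have hd : ∀ k, DifferentiableOn ℂ (h k) (ball z r) := fun k ↦
    have := (differentiableOn_iterate hf hm k).mono hBD
    (this.sub_const a).fun_div (this.sub_const b) (hkb k)
  have h0 : ∀ k, ∀ w ∈ ball z r, h k w ≠ 0 := fun k w hw ↦ div_ne_zero (hka k w hw) (hkb k w hw)
  have hle : ∀ k, ‖logDeriv (h k) z‖ * r ≤ 384 := fun k ↦ by
    refine norm_logDeriv_mul_le_of_injOn hr (hd k) (fun x hx y hy hxy ↦ ?_) (h0 k)
    refine hinj.iterate hm k (hBD hx) (hBD hy) ?_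
    simp only [h] at hxy
    rw [div_eq_div_iff (hkb k x hx) (hkb k y hy)] at hxy
    have : (a - b) * (f^[k] x - f^[k] y) = 0 := by linear_combination hxy
    simpa [sub_ne_zero.2 hab, sub_eq_zero] using this
  have hzn : ball z r ∈ 𝓝 z := ball_mem_nhds z hr
  have hzm : z ∈ ball z r := mem_ball_self hr
  have hev : (fun w ↦ Complex.exp (birkhoffSum f L n w)) =ᶠ[𝓝 z] fun w ↦ h n w / h 0 w := by
    filter_upwards [hzn] with w hw
    exact exp_birkhoffSum_eq hinj hm ha hb hfa hfb hL (hBD hw) (hne w hw).1 (hne w hw).2 n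
  have hS : DifferentiableAt ℂ (birkhoffSum f L n) z :=
    (differentiableOn_birkhoffSum hf hm hLd n).differentiableAt (mem_of_superset hzn hBD)
  have hderiv : deriv (birkhoffSum f L n) z = logDeriv (h n) z - logDeriv (h 0) z := by
    rw [← logDeriv_div z (h0 n z hzm) (h0 0 z hzm) ((hd n).differentiableAt hzn)
      ((hd 0).differentiableAt hzn), logDeriv_apply, ← hev.deriv_eq,
      show h n z / h 0 z = _ from hev.self_of_nhds.symm, hS.hasDerivAt.cexp.deriv]
    field_simp [Complex.exp_ne_zero]
  rw [hderiv]
  calc _ ≤ (‖logDeriv (h n) z‖ + ‖logDeriv (h 0) z‖) * r := by gcongr; exact norm_sub_le _ _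
    _ ≤ 768 := by linarith [hle n, hle 0]

theorem exists_norm_deriv_birkhoffSum_le {f L : ℂ → ℂ} {D : Set ℂ} (hD : IsOpen D)
    (hf : DifferentiableOn ℂ f D) (hinj : InjOn f D) (hm : MapsTo f D D)
    {a b : ℂ} (ha : a ∈ D) (hb : b ∈ D) (hab : a ≠ b) (hfa : f a = a) (hfb : f b = b)
    (hLd : DifferentiableOn ℂ L D)
    (hL : ∀ z ∈ D, Complex.exp (L z) = dslope f a z / dslope f b z) {p : ℂ} (hp : p ∈ D) :
    ∃ r > 0, closedBall p r ⊆ D ∧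
      ∀ n, ∀ z ∈ closedBall p r, ‖deriv (birkhoffSum f L n) z‖ ≤ 768 / r := by
  have hopen : IsOpen (D \ ({a, b} \ {p})) :=
    hD.sdiff ((Set.toFinite _).subset sdiff_subset |>.isClosed)
  obtain ⟨ε, hε, hball⟩ := Metric.isOpen_iff.1 hopen p ⟨hp, by simp⟩
  have hcl : closedBall p (ε / 2) ⊆ D :=
    (closedBall_subset_ball (by linarith)).trans (hball.trans sdiff_subset)
  refine ⟨ε / 2, half_pos hε, hcl, fun n z hz ↦ ?_⟩
  have hdd : DifferentiableOn ℂ (deriv (birkhoffSum f L n)) D :=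
    (differentiableOn_birkhoffSum hf hm hLd n).deriv hD
  rw [← closure_ball p (half_pos hε).ne'] at hz
  refine Complex.norm_le_of_forall_mem_frontier_norm_le isBounded_ball
    (hdd.diffContOnCl_ball hcl) (fun w hw ↦ ?_) hz
  rw [frontier_ball p (half_pos hε).ne', mem_sphere] at hw
  rw [le_div_iff₀ (half_pos hε)]
  refine norm_deriv_birkhoffSum_mul_le hf hinj hm ha hb hab hfa hfb hLd hL (half_pos hε)
    (fun x hx ↦ ?_) n
  rw [mem_ball] at hx
  have hxp : x ∈ ball p ε := by
    rw [mem_ball]; linarith [dist_triangle x w p]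
  have hne : x ≠ p := by
    rintro rfl
    rw [dist_comm] at hw
    linarith
  exact ⟨(hball hxp).1, fun h ↦ (hball hxp).2 ⟨h, hne⟩⟩

/-- Since `L` vanishes at a third fixed point `c`, its Birkhoff sums are locally bounded, uniformly
in `n`. -/
theorem exists_norm_birkhoffSum_le {f L : ℂ → ℂ} {D : Set ℂ} (hD : IsOpen D)
    (hDc : IsPreconnected D)
    (hf : DifferentiableOn ℂ f D) (hinj : InjOn f D) (hm : MapsTo f D D)
    {a b c : ℂ} (ha : a ∈ D) (hb : b ∈ D) (hc : c ∈ D) (hab : a ≠ b)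
    (hfa : f a = a) (hfb : f b = b) (hfc : f c = c)
    (hLd : DifferentiableOn ℂ L D)
    (hL : ∀ z ∈ D, Complex.exp (L z) = dslope f a z / dslope f b z) (hLc : L c = 0)
    {p : ℂ} (hp : p ∈ D) :
    ∃ r > 0, closedBall p r ⊆ D ∧
      ∃ M, ∀ n, ∀ z ∈ closedBall p r, ‖birkhoffSum f L n z‖ ≤ M := by
  have hvar : ∀ p ∈ D, ∃ r > 0, closedBall p r ⊆ D ∧ ∀ n, ∀ z ∈ closedBall p r,
      ‖birkhoffSum f L n z - birkhoffSum f L n p‖ ≤ 768 := fun p hp ↦ by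
    obtain ⟨r, hr, hcl, hC⟩ := exists_norm_deriv_birkhoffSum_le hD hf hinj hm ha hb hab hfa hfb
      hLd hL hp
    refine ⟨r, hr, hcl, fun n z hz ↦ ?_⟩
    calc _ ≤ 768 / r * ‖z - p‖ := (convex_closedBall p r).norm_image_sub_le_of_norm_deriv_le
          (fun w hw ↦ (differentiableOn_birkhoffSum hf hm hLd n).differentiableAt
            (hD.mem_nhds (hcl hw))) (hC n) (mem_closedBall_self hr.le) hz
      _ ≤ 768 / r * r := by gcongr; rwa [← dist_eq_norm]
      _ = 768 := by field_simp
  have hbdd : ∃ M, ∀ n, ‖birkhoffSum f L n p‖ ≤ M := by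
    refine (hDc.induction₂
      (fun x y ↦ (∃ M, ∀ n, ‖birkhoffSum f L n x‖ ≤ M) ↔ ∃ M, ∀ n, ‖birkhoffSum f L n y‖ ≤ M)
      (fun x hx ↦ ?_) (fun _ _ _ _ _ _ h₁ h₂ ↦ h₁.trans h₂) (fun _ _ _ _ h ↦ h.symm) hc hp).1
      ⟨0, fun n ↦ by simp [Function.IsFixedPt.birkhoffSum_eq hfc, hLc]⟩
    obtain ⟨r, hr, -, hv⟩ := hvar x hx
    filter_upwards [mem_nhdsWithin_of_mem_nhds (closedBall_mem_nhds x hr)] with y hy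
    constructor
    · rintro ⟨M, hM⟩
      refine ⟨M + 768, fun n ↦ ?_⟩
      linarith [hM n, hv n y hy, norm_le_insert' (birkhoffSum f L n y) (birkhoffSum f L n x)]
    · rintro ⟨M, hM⟩
      refine ⟨M + 768, fun n ↦ ?_⟩
      linarith [hM n, hv n y hy, norm_le_insert (birkhoffSum f L n y) (birkhoffSum f L n x)]
  obtain ⟨M, hM⟩ := hbdd
  obtain ⟨r, hr, hcl, hv⟩ := hvar p hp
  refine ⟨r, hr, hcl, M + 768, fun n z hz ↦ ?_⟩
  linarith [hM n, hv n z hz, norm_le_insert' (birkhoffSum f L n z) (birkhoffSum f L n p)]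

/-- A holomorphic function either vanishes near `a` or factors through a power of `z - a`. -/
theorem eventually_eq_zero_or_exists_eq_pow_mul {L : ℂ → ℂ} {D : Set ℂ} (hD : IsOpen D)
    (hL : DifferentiableOn ℂ L D) {a : ℂ} (ha : a ∈ D) :
    (∀ᶠ z in 𝓝 a, L z = 0) ∨ ∃ (m : ℕ) (G : ℂ → ℂ), DifferentiableOn ℂ G D ∧ G a ≠ 0 ∧
      ∀ z, L z = (z - a) ^ m * G z := by
  classical
  rw [or_iff_not_imp_left]
  intro hev
  have hLa : AnalyticAt ℂ L a := hL.analyticAt (hD.mem_nhds ha)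
  obtain ⟨m, g, hg, hga, hLg⟩ := hLa.exists_eventuallyEq_pow_smul_nonzero_iff.2 hev
  refine ⟨m, fun z ↦ if z = a then g a else L z / (z - a) ^ m, fun z hz ↦ ?_, by simpa, fun z ↦ ?_⟩
  · apply DifferentiableAt.differentiableWithinAt
    rcases eq_or_ne z a with rfl | hza
    · refine hg.differentiableAt.congr_of_eventuallyEq ?_
      filter_upwards [hLg] with w hw
      split_ifs with h
      · rw [h]
      · rw [hw, smul_eq_mul, mul_div_cancel_left₀ _ (pow_ne_zero _ (sub_ne_zero.2 h))]
    · have hd : DifferentiableAt ℂ (fun w ↦ L w / (w - a) ^ m) z :=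
        (hL.differentiableAt (hD.mem_nhds hz)).fun_div (by fun_prop)
          (pow_ne_zero _ (sub_ne_zero.2 hza))
      refine hd.congr_of_eventuallyEq ?_
      filter_upwards [isOpen_ne.mem_nhds hza] with w hw
      exact if_neg hw
  · rcases eq_or_ne z a with rfl | hza
    · simpa using hLg.self_of_nhds
    · simp only [if_neg hza]
      rw [mul_div_cancel₀ _ (pow_ne_zero _ (sub_ne_zero.2 hza))]

/-- If the Birkhoff sums of `L` are bounded near the fixed point `a`, then `L` vanishes near `a`:
otherwise the leading coefficient of the `n`-th sum would grow linearly in `n`. -/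
theorem eventually_eq_zero_of_norm_birkhoffSum_le {f L : ℂ → ℂ} {D : Set ℂ} (hD : IsOpen D)
    (hf : DifferentiableOn ℂ f D) (hm : MapsTo f D D) (hLd : DifferentiableOn ℂ L D)
    {a : ℂ} (ha : a ∈ D) (hfa : f a = a) (hLa : L a = 0 → deriv f a = 1)
    {r M : ℝ} (hr : 0 < r) (hcl : closedBall a r ⊆ D)
    (hM : ∀ n, ∀ z ∈ closedBall a r, ‖birkhoffSum f L n z‖ ≤ M) :
    ∀ᶠ z in 𝓝 a, L z = 0 := by
  refine (eventually_eq_zero_or_exists_eq_pow_mul hD hLd ha).resolve_right ?_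
  rintro ⟨m, G, hGd, hGa, hG⟩
  have hit : ∀ k, f^[k] a = a := Function.iterate_fixed hfa
  let K : ℕ → ℂ → ℂ := fun n z ↦ ∑ k ∈ Finset.range n, dslope f^[k] a z ^ m * G (f^[k] z)
  have hKd : ∀ n, DifferentiableOn ℂ (K n) D := fun n ↦ DifferentiableOn.fun_sum fun k _ ↦
    (((Complex.differentiableOn_dslope (hD.mem_nhds ha)).2
      (differentiableOn_iterate hf hm k)).pow m).mul
      (hGd.comp (differentiableOn_iterate hf hm k) (hm.iterate k))
  have hK : ∀ n z, birkhoffSum f L n z = (z - a) ^ m * K n z := fun n z ↦ by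
    simp only [birkhoffSum, K, Finset.mul_sum]
    refine Finset.sum_congr rfl fun k _ ↦ ?_
    have := sub_smul_dslope f^[k] a z
    rw [hit, smul_eq_mul] at this
    rw [hG, ← this, mul_pow, mul_assoc]
  have hslope : ∀ k, deriv f^[k] a ^ m = 1 := fun k ↦ by
    rcases Nat.eq_zero_or_pos m with rfl | hmpos
    · exact pow_zero _
    · have h1 : deriv f a = 1 := hLa (by rw [hG]; simp [hmpos.ne'])
      have := (hf.differentiableAt (hD.mem_nhds ha)).hasDerivAt.iterate a hfa k
      rw [this.deriv, h1, one_pow, one_pow]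
  have hKa : ∀ n, K n a = n * G a := fun n ↦ by
    simp [K, dslope_same, hslope, hit]
  have hbound : ∀ n : ℕ, n * ‖G a‖ ≤ M / r ^ m := fun n ↦ by
    have := Complex.norm_le_of_forall_mem_frontier_norm_le (isBounded_ball (x := a) (r := r))
      ((hKd n).diffContOnCl_ball hcl) (C := M / r ^ m) (fun w hw ↦ ?_)
      (subset_closure (mem_ball_self hr))
    · simpa [hKa] using this
    · rw [frontier_ball a hr.ne'] at hw
      have h1 := hM n w (sphere_subset_closedBall hw)
      rw [hK, norm_mul, norm_pow, ← dist_eq_norm, mem_sphere.1 hw] at h1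
      rwa [le_div_iff₀' (pow_pos hr m)]
  obtain ⟨n, hn⟩ := exists_nat_gt (M / r ^ m / ‖G a‖)
  rw [div_lt_iff₀ (norm_pos_iff.2 hGa)] at hn
  exact (hbound n).not_gt hn

/-- An injective holomorphic self-map of a domain with nonvanishing derivative and three fixed
points is the identity. -/
theorem eqOn_id_of_three_fixed_points {f : ℂ → ℂ} {D : Set ℂ} (hD : IsOpen D)
    (hDc : IsConnected D) (hf : DifferentiableOn ℂ f D) (hinj : InjOn f D) (hm : MapsTo f D D)
    (hf' : ∀ z ∈ D, deriv f z ≠ 0) {a b c : ℂ} (ha : a ∈ D) (hb : b ∈ D) (hc : c ∈ D)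
    (hab : a ≠ b) (hca : c ≠ a) (hcb : c ≠ b) (hfa : f a = a) (hfb : f b = b) (hfc : f c = c) :
    EqOn f id D := by
  obtain ⟨L₀, hL₀d, hL₀⟩ := exists_exp_eq_dslope_div_dslope hD hDc hf hinj hf' ha hb
  have hslope : ∀ {x y : ℂ}, y ≠ x → f x = x → f y = y → dslope f x y = 1 := fun hyx hx hy ↦ by
    rw [dslope_of_ne f hyx, slope, vsub_eq_sub, smul_eq_mul, hx, hy,
      inv_mul_cancel₀ (sub_ne_zero.2 hyx)]
  have hL₀c : Complex.exp (L₀ c) = 1 := by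
    rw [hL₀ c hc, hslope hca hfa hfc, hslope hcb hfb hfc, div_one]
  let L : ℂ → ℂ := fun z ↦ L₀ z - L₀ c
  have hLd : DifferentiableOn ℂ L D := hL₀d.sub_const _
  have hL : ∀ z ∈ D, Complex.exp (L z) = dslope f a z / dslope f b z := fun z hz ↦ by
    rw [Complex.exp_sub, hL₀c, div_one, hL₀ z hz]
  obtain ⟨r, hr, hcl, M, hM⟩ := exists_norm_birkhoffSum_le hD hDc.isPreconnected hf hinj hm ha hb hc
    hab hfa hfb hfc hLd hL (sub_self _) ha
  have hLa : L a = 0 → deriv f a = 1 := fun h ↦ by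
    have := hL a ha
    rwa [h, Complex.exp_zero, dslope_same, hslope hab hfb hfa, div_one, eq_comm] at this
  have hev := eventually_eq_zero_of_norm_birkhoffSum_le hD hf hm hLd ha hfa hLa hr hcl hM
  refine (hf.analyticOnNhd hD).eqOn_of_preconnected_of_eventuallyEq
    (differentiableOn_id.analyticOnNhd hD) hDc.isPreconnected ha ?_
  filter_upwards [hev, hD.mem_nhds ha, isOpen_ne.mem_nhds hab] with z hz hzD hzb
  rcases eq_or_ne z a with rfl | hza
  · exact hfa
  have h1 := exp_birkhoffSum_eq hinj hm ha hb hfa hfb hL hzD hza hzb 1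
  have hwb := iterate_ne_of_injOn hinj hm hb hzD hfb hzb 1
  rw [birkhoffSum_one, hz, Complex.exp_zero, eq_div_iff (div_ne_zero (sub_ne_zero.2 hza)
    (sub_ne_zero.2 hzb)), one_mul, div_eq_div_iff (sub_ne_zero.2 hzb) (sub_ne_zero.2 hwb)] at h1
  have h2 : (a - b) * (f z - z) = 0 := by
    simp only [Function.iterate_one] at h1
    linear_combination -h1
  simpa [sub_ne_zero.2 hab, sub_eq_zero] using h2

theorem deriv_ne_zero_of_leftInvOn {f g : ℂ → ℂ} {D : Set ℂ} (hD : IsOpen D)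
    (hf : DifferentiableOn ℂ f D) (hg : DifferentiableOn ℂ g D) (hm : MapsTo f D D)
    (hgf : LeftInvOn g f D) {z : ℂ} (hz : z ∈ D) : deriv f z ≠ 0 := fun h0 ↦ by
  have hfz := (hf.differentiableAt (hD.mem_nhds hz)).hasDerivAt
  have hgz := (hg.differentiableAt (hD.mem_nhds (hm hz))).hasDerivAt
  have hid : g ∘ f =ᶠ[𝓝 z] id := by
    filter_upwards [hD.mem_nhds hz] with w hw using hgf hw
  have := ((hgz.comp z hfz).congr_of_eventuallyEq hid.symm).unique (hasDerivAt_id z)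
  simp [h0] at this

end

/-- A non-identity automorphism of a planar domain has at most two fixed points. -/
theorem planar_automorphism_at_most_two_fixed_points (D : Set ℂ)
    (hDopen : IsOpen D) (hDconn : IsConnected D)
    (f : ℂ → ℂ) (hf : PlanarAutOn D f) (hne : ∃ z ∈ D, f z ≠ z) :
    ∃ a b : ℂ, {z ∈ D | f z = z} ⊆ {a, b} := by
  obtain ⟨hfd, hbij, g, hgd, -, hgf, -⟩ := hf
  have hf' : ∀ z ∈ D, deriv f z ≠ 0 := fun z hz ↦
    deriv_ne_zero_of_leftInvOn hDopen hfd hgd hbij.mapsTo hgf hz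
  by_contra! hcon
  obtain ⟨a, ⟨ha, hfa⟩, -⟩ := not_subset.1 (hcon 0 0)
  obtain ⟨b, ⟨hb, hfb⟩, hba⟩ := not_subset.1 (hcon a a)
  obtain ⟨c, ⟨hc, hfc⟩, hcab⟩ := not_subset.1 (hcon a b)
  simp only [mem_insert_iff, mem_singleton_iff, or_self, not_or] at hba hcab
  obtain ⟨z, hz, hfz⟩ := hne
  exact hfz (eqOn_id_of_three_fixed_points hDopen hDconn hfd hbij.injOn hbij.mapsTo hf' ha hb hc
    (Ne.symm hba) hcab.1 hcab.2 hfa hfb hfc hz)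
end
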